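/- Let p ≥ 4 and let a, b be integers with 2 ≤ a ≤ p−2, 2 ≤ b ≤ p−2 and a + b odd. For every real q with 0 < q < 1, Σ_{m} q^{(m·C m)/4 − m_1/2 − m_b/2} (1/(q)_{m_1}) ∏_{j=2}^{p−2} [ (½ I m)_j + ½(δ_{a,j} + δ_{b,j}) choose m_j ]_q = q^{φ̃(a,b)} ( χ^{p,p+1}_{a,b+2}(q) + q^{a−b} χ^{p,p+1}_{a,b}(q) ), where the sum runs over all m = (m_1, …, m_{p−2}) ∈ ℤ^{p−2} with nonnegative entries and m_{p−2} even, φ̃(a,b) = (b−a)(b−a+3)/4, and both sides converge absolutely. -/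

import Mathlib

open Finset

noncomputable section

/-- `(q)_k = ∏_{j=1}^k (1 - q^j)`. -/
def qPoch (q : ℝ) (k : ℕ) : ℝ := ∏ j ∈ Finset.range k, (1 - q ^ (j + 1))

/-- `(q)_∞`. -/
def qPochInf (q : ℝ) : ℝ := ∏' j : ℕ, (1 - q ^ (j + 1))

/-- Incidence matrix `I` of `A_{p-2}`, rows/columns labelled by `1, …, p-2`
(index `i : Fin (p-2)` carries the label `i.val + 1`). -/
def IncA (p : ℕ) (i j : Fin (p - 2)) : ℚ :=
  if i.val = j.val + 1 ∨ j.val = i.val + 1 then 1 else 0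

/-- Cartan matrix `C = 2·Id - I` of `A_{p-2}`. -/
def CarA (p : ℕ) (i j : Fin (p - 2)) : ℚ := (if i = j then 2 else 0) - IncA p i j

/-- `q`-binomial coefficient with (possibly non-integral) rational top entry:
it vanishes unless the top is an integer `N` with `0 ≤ m ≤ N`. -/
def qBinQ (q : ℝ) (N : ℚ) (m : ℕ) : ℝ :=
  if N.den = 1 ∧ (m : ℚ) ≤ N then
    qPoch q N.num.toNat / (qPoch q m * qPoch q (N.num.toNat - m))
  else 0

def phitR (a b : ℝ) : ℝ := (b - a) * (b - a + 3) / 4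

/-- Virasoro character `χ^{p,p+1}_{r,s}(q)` of the minimal model `M(p,p+1)`. -/
def chiV (p r s : ℤ) (q : ℝ) : ℝ :=
  (∑' j : ℤ, (q ^ (p * (p + 1) * j ^ 2 + j * ((p + 1) * r - p * s))
      - q ^ ((p * j + r) * ((p + 1) * j + s)))) / qPochInf q


/-! ### q-binomials with integer entries -/

lemma qPoch_zero (q : ℝ) : qPoch q 0 = 1 := by simp [qPoch]

lemma qPoch_succ (q : ℝ) (k : ℕ) : qPoch q (k + 1) = qPoch q k * (1 - q ^ (k + 1)) := by
  simp [qPoch, Finset.prod_range_succ]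

lemma qfac_pos {q : ℝ} (hq0 : 0 < q) (hq1 : q < 1) (k : ℕ) : 0 < 1 - q ^ (k + 1) := by
  have : q ^ (k + 1) < 1 := pow_lt_one₀ hq0.le hq1 (by omega)
  linarith

lemma qPoch_pos {q : ℝ} (hq0 : 0 < q) (hq1 : q < 1) (k : ℕ) : 0 < qPoch q k :=
  Finset.prod_pos fun j _ => qfac_pos hq0 hq1 j

/-- q-binomial with integer entries. -/
def qb (q : ℝ) (N m : ℤ) : ℝ :=
  if 0 ≤ m ∧ m ≤ N then qPoch q N.toNat / (qPoch q m.toNat * qPoch q (N - m).toNat) else 0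

lemma qb_neg (q : ℝ) {N m : ℤ} (h : m < 0) : qb q N m = 0 := by
  unfold qb; rw [if_neg]; omega

lemma qb_gt (q : ℝ) {N m : ℤ} (h : N < m) : qb q N m = 0 := by
  unfold qb; rw [if_neg]; omega

lemma qb_nonneg {q : ℝ} (hq0 : 0 < q) (hq1 : q < 1) (N m : ℤ) : 0 ≤ qb q N m := by
  unfold qb
  split_ifs
  · exact div_nonneg (qPoch_pos hq0 hq1 _).le
      (mul_nonneg (qPoch_pos hq0 hq1 _).le (qPoch_pos hq0 hq1 _).le)
  · exact le_rfl

lemma qb_nat (q : ℝ) (i d : ℕ) :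
    qb q ((i : ℤ) + d) i = qPoch q (i + d) / (qPoch q i * qPoch q d) := by
  unfold qb
  rw [if_pos (by omega)]
  congr 2
  congr 1
  omega

lemma qb_symm (q : ℝ) (N m : ℤ) : qb q N (N - m) = qb q N m := by
  unfold qb
  have : N - (N - m) = m := by ring
  rw [this, mul_comm]
  congr 1
  apply propext; omega

lemma qb_zero_right {q : ℝ} (hq0 : 0 < q) (hq1 : q < 1) {N : ℤ} (h : 0 ≤ N) : qb q N 0 = 1 := by
  obtain ⟨d, rfl⟩ := Int.eq_ofNat_of_zero_le h
  have := qb_nat q 0 d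
  simp only [Nat.cast_zero, zero_add, qPoch_zero, one_mul] at this
  rw [this, div_self (qPoch_pos hq0 hq1 _).ne']

lemma qb_self {q : ℝ} (hq0 : 0 < q) (hq1 : q < 1) {N : ℤ} (h : 0 ≤ N) : qb q N N = 1 := by
  rw [← qb_symm, sub_self, qb_zero_right hq0 hq1 h]

lemma qb_pascal {q : ℝ} (hq0 : 0 < q) (hq1 : q < 1) {N : ℤ} (hN : 1 ≤ N) (m : ℤ) :
    qb q N m = q ^ m * qb q (N - 1) m + qb q (N - 1) (m - 1) := by
  rcases lt_trichotomy m 0 with h | h | h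
  · rw [qb_neg q h, qb_neg q h, qb_neg q (by omega)]; ring
  · subst h
    rw [qb_zero_right hq0 hq1 (by omega), qb_zero_right hq0 hq1 (by omega), qb_neg q (by omega)]
    simp
  rcases lt_trichotomy m N with h' | h' | h'
  · obtain ⟨i, rfl⟩ : ∃ i : ℕ, m = ((i + 1 : ℕ) : ℤ) := ⟨(m - 1).toNat, by omega⟩
    obtain ⟨d, rfl⟩ : ∃ d : ℕ, N = ((i + 1 : ℕ) : ℤ) + ((d + 1 : ℕ) : ℤ) :=
      ⟨(N - (i + 1) - 1).toNat, by push_cast at *; omega⟩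
    have e1 : ((i + 1 : ℕ) : ℤ) + ((d + 1 : ℕ) : ℤ) - 1 = ((i + 1 : ℕ) : ℤ) + (d : ℕ) := by
      push_cast; ring
    have e2 : ((i + 1 : ℕ) : ℤ) + (d : ℕ) = ((i : ℕ) : ℤ) + ((d + 1 : ℕ) : ℤ) := by
      push_cast; ring
    have e3 : ((i + 1 : ℕ) : ℤ) - 1 = (i : ℕ) := by push_cast; ring
    rw [qb_nat, e1, qb_nat, e2, e3, qb_nat, zpow_natCast]
    have a1 : i + 1 + (d + 1) = (i + d + 1) + 1 := by ring
    have a2 : i + 1 + d = i + d + 1 := by ring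
    have a3 : i + (d + 1) = i + d + 1 := by ring
    rw [a1, a2, a3, qPoch_succ q (i + d + 1), qPoch_succ q i, qPoch_succ q d]
    have h1 := (qPoch_pos hq0 hq1 i).ne'
    have h2 := (qPoch_pos hq0 hq1 d).ne'
    have h3 := (qfac_pos hq0 hq1 i).ne'
    have h4 := (qfac_pos hq0 hq1 d).ne'
    field_simp
    ring
  · subst h'
    rw [qb_self hq0 hq1 (by omega), qb_gt q (by omega), qb_self hq0 hq1 (by omega)]; ring
  · rw [qb_gt q h', qb_gt q (by omega), qb_gt q (by omega)]; ring

lemma qb_pascal' {q : ℝ} (hq0 : 0 < q) (hq1 : q < 1) {N : ℤ} (hN : 1 ≤ N) (m : ℤ) :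
    qb q N m = qb q (N - 1) m + q ^ (N - m) * qb q (N - 1) (m - 1) := by
  rw [← qb_symm, qb_pascal hq0 hq1 hN, ← qb_symm q (N - 1) m, ← qb_symm q (N - 1) (m - 1)]
  have e1 : N - 1 - m = N - m - 1 := by ring
  have e2 : N - 1 - (m - 1) = N - m := by ring
  rw [e1, e2]; ring

lemma qb_absorb {q : ℝ} (hq0 : 0 < q) (hq1 : q < 1) {N : ℤ} (hN : 1 ≤ N) (m : ℤ) :
    (1 - q ^ (N - m)) * qb q N m = (1 - q ^ N) * qb q (N - 1) m := by
  rcases lt_or_ge m 0 with h | h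
  · rw [qb_neg q h, qb_neg q h]; ring
  rcases lt_trichotomy m N with h' | h' | h'
  · obtain ⟨i, rfl⟩ : ∃ i : ℕ, m = (i : ℤ) := ⟨m.toNat, by omega⟩
    obtain ⟨d, rfl⟩ : ∃ d : ℕ, N = (i : ℤ) + ((d + 1 : ℕ) : ℤ) :=
      ⟨(N - i - 1).toNat, by push_cast at *; omega⟩
    have e1 : (i : ℤ) + ((d + 1 : ℕ) : ℤ) - 1 = (i : ℤ) + (d : ℕ) := by
      push_cast; ring
    have e2 : (i : ℤ) + ((d + 1 : ℕ) : ℤ) - i = ((d + 1 : ℕ) : ℤ) := by ring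
    rw [e2, e1, qb_nat, qb_nat, zpow_natCast, ← Nat.cast_add, zpow_natCast]
    have a3 : i + (d + 1) = i + d + 1 := by ring
    rw [a3, qPoch_succ q (i + d), qPoch_succ q d]
    have h1 := (qPoch_pos hq0 hq1 i).ne'
    have h2 := (qPoch_pos hq0 hq1 d).ne'
    have h4 := (qfac_pos hq0 hq1 d).ne'
    field_simp
  · subst h'
    rw [qb_gt q (show m - 1 < m by omega)]; simp
  · rw [qb_gt q h', qb_gt q (by omega)]; ring

/-- three-term recurrence for the top entry -/
lemma qb_rec {q : ℝ} (hq0 : 0 < q) (hq1 : q < 1) {N : ℤ} (hN : 0 ≤ N) (m : ℤ) :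
    qb q (N + 2) m = (q ^ (N + 1) - 1) * qb q N (m - 1) + qb q (N + 1) m
      + qb q (N + 1) (m - 1) := by
  have h1 := qb_pascal' hq0 hq1 (show 1 ≤ N + 2 by omega) m
  have h2 := qb_absorb hq0 hq1 (show 1 ≤ N + 1 by omega) (m - 1)
  have e1 : N + 2 - 1 = N + 1 := by ring
  have e2 : N + 1 - (m - 1) = N + 2 - m := by ring
  have e3 : N + 1 - 1 = N := by ring
  rw [e1] at h1
  rw [e2, e3] at h2
  linarith

/-- half-integer top entry: zero unless `N2` is even, and then `[N2/2 choose m]`. -/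
def qb2 (q : ℝ) (N2 m : ℤ) : ℝ := if Even N2 then qb q (N2 / 2) m else 0

lemma qb2_nonneg {q : ℝ} (hq0 : 0 < q) (hq1 : q < 1) (N m : ℤ) : 0 ≤ qb2 q N m := by
  unfold qb2; split_ifs
  · exact qb_nonneg hq0 hq1 _ _
  · exact le_rfl

lemma qb2_pascal {q : ℝ} (hq0 : 0 < q) (hq1 : q < 1) {N : ℤ} (hN : 1 ≤ N) (m : ℤ) :
    qb2 q N m = q ^ m * qb2 q (N - 2) m + qb2 q (N - 2) (m - 1) := by
  unfold qb2
  by_cases h : Even N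
  · have h' : Even (N - 2) := h.sub even_two
    rw [if_pos h, if_pos h', if_pos h']
    obtain ⟨k, rfl⟩ := h
    have e1 : (k + k) / 2 = k := by omega
    have e2 : (k + k - 2) / 2 = k - 1 := by omega
    rw [e1, e2]
    exact qb_pascal hq0 hq1 (by omega) m
  · have h' : ¬ Even (N - 2) := by
      intro h2; apply h
      have := h2.add even_two
      simpa using this
    simp [h, h']

lemma qb2_ne_zero {q : ℝ} {N m : ℤ} (h : qb2 q N m ≠ 0) : Even N ∧ 0 ≤ m ∧ 2 * m ≤ N := by
  unfold qb2 at h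
  split_ifs at h with h1
  · unfold qb at h
    split_ifs at h with h2
    · refine ⟨h1, h2.1, by omega⟩
    · exact absurd rfl h
  · exact absurd rfl h

/-! ### Fermionic sums -/

/-- unit vector -/
def ev (j : ℕ) : ℕ → ℤ := fun i => if i = j then 1 else 0

/-- extension by zero, shifted by one: node `i+1` carries `m i`. -/
def ex {n : ℕ} (m : Fin n → ℕ) : ℕ → ℤ
  | 0 => 0
  | i + 1 => if h : i < n then (m ⟨i, h⟩ : ℤ) else 0

lemma ex_nonneg {n : ℕ} (m : Fin n → ℕ) (i : ℕ) : 0 ≤ ex m i := by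
  cases i with
  | zero => simp [ex]
  | succ i => simp only [ex]; split_ifs <;> omega

lemma ex_zero {n : ℕ} (m : Fin n → ℕ) : ex m 0 = 0 := rfl

lemma ex_last {n : ℕ} (m : Fin n → ℕ) : ex m (n + 1) = 0 := by simp [ex]

/-- quadratic exponent -/
def EE (n : ℕ) (u X : ℕ → ℤ) : ℤ :=
  ∑ i ∈ range n, X (i + 1) * (2 * X (i + 1) - X i - X (i + 2) - 2 * u (i + 1))

def TT (n : ℕ) (t : ℝ) (A u X : ℕ → ℤ) : ℝ :=
  (if Even (X n + u (n + 1)) then 1 else 0) * t ^ EE n u X *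
    ∏ i ∈ range n, qb2 (t ^ 4) (X i + X (i + 2) + u (i + 1) + A (i + 1)) (X (i + 1))

def GG (n : ℕ) (t : ℝ) (A u : ℕ → ℤ) : ℝ := ∑' m : Fin n → ℕ, TT n t A u (ex m)

lemma abel_sum (X w : ℕ → ℤ) (n : ℕ) :
    ∑ i ∈ range n, w (i + 1) * (2 * X (i + 1) - X i - X (i + 2))
      = ∑ i ∈ range n, X (i + 1) * (2 * w (i + 1) - w i - w (i + 2))
        + (X 1 * w 0 - X 0 * w 1) - (X (n + 1) * w n - X n * w (n + 1)) := by
  induction n with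
  | zero => simp
  | succ n ih => rw [sum_range_succ, sum_range_succ, ih]; ring

lemma EE_sub (n : ℕ) (u X : ℕ → ℤ) (k : ℕ) (hk : k < n) :
    EE n (u - 2 • ev (k + 1)) X = EE n u X + 4 * X (k + 1) := by
  unfold EE
  have : 4 * X (k + 1) = ∑ i ∈ range n, if i = k then 4 * X (k + 1) else 0 := by
    rw [sum_ite_eq' (range n) k]; simp [hk]
  rw [this, ← sum_add_distrib]
  refine sum_congr rfl fun i _ => ?_
  by_cases h : i = k
  · subst h; simp [ev]; ring
  · simp [ev, h]

lemma EE_shift (n : ℕ) (u X : ℕ → ℤ) (k : ℕ) (hk : k < n) (h0 : X 0 = 0) (hn : X (n + 1) = 0) :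
    EE n u X = EE n (u - 2 • ev (k + 1) + ev k + ev (k + 2)) (X - ev (k + 1))
      + (2 - 2 * u (k + 1)) := by
  unfold EE
  -- the difference telescopes
  have key : ∀ N, ∑ i ∈ range N, (X (i + 1) * (2 * X (i + 1) - X i - X (i + 2) - 2 * u (i + 1))
      - (X - ev (k + 1)) (i + 1) * (2 * (X - ev (k + 1)) (i + 1) - (X - ev (k + 1)) i
        - (X - ev (k + 1)) (i + 2) - 2 * (u - 2 • ev (k + 1) + ev k + ev (k + 2)) (i + 1)))
      = if N ≤ k then (if N = k then X k else 0) else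
        (2 - 2 * u (k + 1)) - (if N = k + 1 then X (k + 2) else 0) := by
    intro N
    induction N with
    | zero =>
      simp only [range_zero, sum_empty, Nat.zero_le, if_true]
      split_ifs with h
      · subst h; simp [h0]
      · simp
    | succ N ih =>
      rw [sum_range_succ, ih]
      rcases lt_trichotomy (N + 1) k with h | h | h
      · simp [ev, show N ≤ k by omega, show N ≠ k by omega, show N + 1 ≤ k by omega,
          show N + 1 ≠ k by omega, show N + 2 ≠ k + 1 by omega, show N ≠ k + 1 by omega]
      · subst h
        simp [ev, show N ≠ N + 1 + 1 by omega]
        ring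
      · by_cases h1 : N = k
        · subst h1
          simp [ev]
          ring
        · by_cases h2 : N = k + 1
          · subst h2
            simp [ev, show k + 1 + 1 ≠ k by omega]
            ring
          · simp [ev, show ¬ N ≤ k by omega, h1, h2, show ¬ N + 1 ≤ k by omega,
              show N + 1 ≠ k by omega]
  have := key n
  rw [sum_sub_distrib] at this
  rw [if_neg (by omega)] at this
  have h3 : (if n = k + 1 then X (k + 2) else 0) = 0 := by
    split_ifs with h
    · subst h; exact hn
    · rfl
  rw [h3] at this
  linarith

lemma TT_pascal (n : ℕ) {t : ℝ} (ht0 : 0 < t) (ht1 : t < 1) (A u X : ℕ → ℤ) (k : ℕ) (hk : k < n)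
    (hX : ∀ i, 0 ≤ X i) (hA : ∀ i, 0 ≤ A i) (h0 : X 0 = 0) (hn : X (n + 1) = 0)
    (hu : 1 ≤ u (k + 1)) :
    TT n t A u X = TT n t A (u - 2 • ev (k + 1)) X + t ^ (2 - 2 * u (k + 1)) *
      TT n t A (u - 2 • ev (k + 1) + ev k + ev (k + 2)) (X - ev (k + 1)) := by
  have hq0 : 0 < t ^ 4 := by positivity
  have hq1 : t ^ 4 < 1 := pow_lt_one₀ ht0.le ht1 (by norm_num)
  have hkm : k ∈ range n := by simpa using hk
  unfold TT
  -- parity factors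
  have par1 : ((u - 2 • ev (k + 1)) (n + 1)) = u (n + 1) := by
    simp [ev]; omega
  have par2 : (X - ev (k + 1)) n + (u - 2 • ev (k + 1) + ev k + ev (k + 2)) (n + 1)
      = X n + u (n + 1) := by
    simp only [Pi.add_apply, Pi.sub_apply, Pi.smul_apply, ev]
    rw [if_neg (show ¬ n + 1 = k + 1 by omega), if_neg (show ¬ n + 1 = k by omega)]
    by_cases h : n = k + 1
    · simp [h]
    · simp [h]
  rw [par1, par2, EE_sub n u X k hk]
  set E' := EE n (u - 2 • ev (k + 1) + ev k + ev (k + 2)) (X - ev (k + 1)) with hE'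
  have hE : EE n u X = E' + (2 - 2 * u (k + 1)) := EE_shift n u X k hk h0 hn
  rw [← mul_prod_erase _ _ hkm, ← mul_prod_erase _ _ hkm, ← mul_prod_erase _ _ hkm]
  have P1 : ∏ i ∈ (range n).erase k,
      qb2 (t ^ 4) (X i + X (i + 2) + (u - 2 • ev (k + 1)) (i + 1) + A (i + 1)) (X (i + 1))
      = ∏ i ∈ (range n).erase k,
        qb2 (t ^ 4) (X i + X (i + 2) + u (i + 1) + A (i + 1)) (X (i + 1)) := by
    refine prod_congr rfl fun i hi => ?_
    have : i ≠ k := (mem_erase.1 hi).1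
    congr 2
    simp [ev, this]
  have P2 : ∏ i ∈ (range n).erase k,
      qb2 (t ^ 4) ((X - ev (k + 1)) i + (X - ev (k + 1)) (i + 2)
        + (u - 2 • ev (k + 1) + ev k + ev (k + 2)) (i + 1) + A (i + 1)) ((X - ev (k + 1)) (i + 1))
      = ∏ i ∈ (range n).erase k,
        qb2 (t ^ 4) (X i + X (i + 2) + u (i + 1) + A (i + 1)) (X (i + 1)) := by
    refine prod_congr rfl fun i hi => ?_
    have hik : i ≠ k := (mem_erase.1 hi).1
    congr 1
    · simp only [Pi.add_apply, Pi.sub_apply, Pi.smul_apply, ev]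
      rw [if_neg (show ¬ i + 1 = k + 1 by omega)]
      by_cases h1 : i = k + 1
      · subst h1; simp [show k + 1 + 1 ≠ k by omega]; ring
      · by_cases h2 : i + 1 = k
        · subst h2; simp [show i ≠ i + 1 + 1 by omega]; ring
        · simp [h1, h2, show i + 2 ≠ k + 1 by omega]
    · simp [ev, hik]
  rw [P1, P2]
  have hN : 1 ≤ X k + X (k + 2) + u (k + 1) + A (k + 1) := by
    have := hX k; have := hX (k + 2); have := hA (k + 1); omega
  have f1 : X k + X (k + 2) + (u - 2 • ev (k + 1)) (k + 1) + A (k + 1)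
      = X k + X (k + 2) + u (k + 1) + A (k + 1) - 2 := by
    simp [ev]; ring
  have f2 : (X - ev (k + 1)) k + (X - ev (k + 1)) (k + 2)
        + (u - 2 • ev (k + 1) + ev k + ev (k + 2)) (k + 1) + A (k + 1)
      = X k + X (k + 2) + u (k + 1) + A (k + 1) - 2 := by
    simp [ev]; ring
  have f3 : (X - ev (k + 1)) (k + 1) = X (k + 1) - 1 := by simp [ev]
  rw [f1, f2, f3, qb2_pascal hq0 hq1 hN]
  have g1 : t ^ (EE n u X + 4 * X (k + 1)) = t ^ EE n u X * (t ^ 4) ^ X (k + 1) := by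
    rw [zpow_add₀ ht0.ne', zpow_mul]; norm_cast
  have g2 : t ^ EE n u X = t ^ E' * t ^ (2 - 2 * u (k + 1)) := by
    rw [hE, zpow_add₀ ht0.ne']
  rw [g1]
  generalize ∏ i ∈ (range n).erase k,
        qb2 (t ^ 4) (X i + X (i + 2) + u (i + 1) + A (i + 1)) (X (i + 1)) = PP
  rw [g2]
  ring

lemma TT_support (n : ℕ) {t : ℝ} (A u X : ℕ → ℤ) (h : TT n t A u X ≠ 0) :
    Even (X n + u (n + 1)) ∧ ∀ i < n, Even (X i + X (i + 2) + u (i + 1) + A (i + 1)) ∧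
      2 * X (i + 1) ≤ X i + X (i + 2) + u (i + 1) + A (i + 1) ∧ 0 ≤ X (i + 1) := by
  unfold TT at h
  constructor
  · by_contra h'
    simp [h'] at h
  · intro i hi
    have h2 := right_ne_zero_of_mul h
    rw [prod_ne_zero_iff] at h2
    have := qb2_ne_zero (h2 i (by simpa using hi))
    exact ⟨this.1, this.2.2, this.2.1⟩

lemma ex_sum_le {n : ℕ} (A u : ℕ → ℤ) (m : Fin n → ℕ)
    (h : ∀ i < n, 2 * ex m (i + 1) ≤ ex m i + ex m (i + 2) + u (i + 1) + A (i + 1)) :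
    2 * ∑ i ∈ range n, ex m (i + 1) ≤
      ∑ i ∈ range n, ((i : ℤ) + 1) * (n - i) * (u (i + 1) + A (i + 1)) := by
  have := abel_sum (ex m) (fun i => (i : ℤ) * (n + 1 - i)) n
  simp only [ex_zero, ex_last] at this
  have e1 : ∑ i ∈ range n, ex m (i + 1) * (2 * (((i + 1 : ℕ) : ℤ) * (n + 1 - ((i + 1 : ℕ) : ℤ)))
      - (i : ℤ) * (n + 1 - i) - ((i + 2 : ℕ) : ℤ) * (n + 1 - ((i + 2 : ℕ) : ℤ)))
      = 2 * ∑ i ∈ range n, ex m (i + 1) := by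
    rw [mul_sum]
    refine sum_congr rfl fun i _ => ?_
    push_cast; ring
  rw [e1] at this
  have e2 : ∑ i ∈ range n, ((i + 1 : ℕ) : ℤ) * (n + 1 - ((i + 1 : ℕ) : ℤ))
      * (2 * ex m (i + 1) - ex m i - ex m (i + 2))
      ≤ ∑ i ∈ range n, ((i : ℤ) + 1) * (n - i) * (u (i + 1) + A (i + 1)) := by
    refine sum_le_sum fun i hi => ?_
    have hi' : i < n := by simpa using hi
    have h1 := h i hi'
    have e3 : ((i + 1 : ℕ) : ℤ) * (n + 1 - ((i + 1 : ℕ) : ℤ)) = ((i : ℤ) + 1) * (n - i) := by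
      push_cast; ring
    rw [e3]
    apply mul_le_mul_of_nonneg_left (by linarith)
    apply mul_nonneg <;> omega
  have e4 : ((n + 1 : ℕ) : ℤ) = n + 1 := by push_cast; ring
  simp only [e4, sub_self, Nat.cast_zero, zero_mul, mul_zero, sub_zero, add_zero] at this
  linarith

lemma TT_finite (n : ℕ) {t : ℝ} (A u : ℕ → ℤ) :
    (Function.support fun m : Fin n → ℕ => TT n t A u (ex m)).Finite := by
  set B : ℤ := ∑ i ∈ range n, ((i : ℤ) + 1) * (n - i) * (u (i + 1) + A (i + 1))
  refine (Set.finite_Iic (fun _ : Fin n => B.toNat)).subset ?_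
  intro m hm
  have h := (TT_support n A u (ex m) hm).2
  have h1 := ex_sum_le A u m fun i hi => (h i hi).2.1
  intro i
  have h2 : ex m (i.val + 1) ≤ ∑ i ∈ range n, ex m (i + 1) :=
    single_le_sum (f := fun i => ex m (i + 1)) (fun j _ => ex_nonneg m _)
      (by simp)
  have h3 : ex m (i.val + 1) = m i := by simp [ex]
  have h4 : 0 ≤ ∑ i ∈ range n, ex m (i + 1) := sum_nonneg fun j _ => ex_nonneg m _
  change m i ≤ B.toNat
  omega

lemma TT_summable (n : ℕ) {t : ℝ} (A u : ℕ → ℤ) :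
    Summable fun m : Fin n → ℕ => TT n t A u (ex m) :=
  summable_of_hasFiniteSupport (TT_finite n A u)

lemma ex_add_single {n : ℕ} (m : Fin n → ℕ) (k : ℕ) (hk : k < n) :
    ex (m + Pi.single ⟨k, hk⟩ 1) - ev (k + 1) = ex m := by
  funext i
  cases i with
  | zero => simp [ex, ev]
  | succ i =>
    simp only [Pi.sub_apply, ex, ev]
    by_cases h : i < n
    · by_cases h1 : i = k
      · subst h1; simp [h]
      · simp [h, h1]
    · simp [h, show i ≠ k by omega]

lemma GG_shift (n : ℕ) {t : ℝ} (A u : ℕ → ℤ) (k : ℕ) (hk : k < n) :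
    HasSum (fun m : Fin n → ℕ => TT n t A u (ex m - ev (k + 1))) (GG n t A u) := by
  have hinj : Function.Injective (fun m : Fin n → ℕ => m + Pi.single ⟨k, hk⟩ 1) :=
    add_left_injective _
  rw [← hinj.hasSum_iff]
  · have : ((fun m : Fin n → ℕ => TT n t A u (ex m - ev (k + 1))) ∘
        fun m : Fin n → ℕ => m + Pi.single ⟨k, hk⟩ 1) = fun m => TT n t A u (ex m) := by
      funext m
      simp only [Function.comp]
      rw [ex_add_single]
    rw [this]
    exact (TT_summable n A u).hasSum
  · intro m hm
    by_contra h
    apply hm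
    have := (TT_support n A u _ h).2 k hk
    have h1 : 0 ≤ (ex m - ev (k + 1)) (k + 1) := this.2.2
    have h2 : 1 ≤ m ⟨k, hk⟩ := by
      simp [ex, ev, hk] at h1
      omega
    refine ⟨m - Pi.single ⟨k, hk⟩ 1, ?_⟩
    funext i
    simp only [Pi.add_apply, Pi.sub_apply]
    by_cases hi : i = ⟨k, hk⟩
    · subst hi; simp; omega
    · simp [hi]

lemma GG_pascal (n : ℕ) {t : ℝ} (ht0 : 0 < t) (ht1 : t < 1) (A u : ℕ → ℤ) (k : ℕ) (hk : k < n)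
    (hA : ∀ i, 0 ≤ A i) (hu : 1 ≤ u (k + 1)) :
    GG n t A u = GG n t A (u - 2 • ev (k + 1)) + t ^ (2 - 2 * u (k + 1)) *
      GG n t A (u - 2 • ev (k + 1) + ev k + ev (k + 2)) := by
  have h1 := (TT_summable n (t := t) A (u - 2 • ev (k + 1))).hasSum
  have h2 := (GG_shift n (t := t) A (u - 2 • ev (k + 1) + ev k + ev (k + 2)) k hk).mul_left
    (t ^ (2 - 2 * u (k + 1)))
  have h3 := h1.add h2
  have : (fun m : Fin n → ℕ => TT n t A u (ex m)) = fun m => TT n t A (u - 2 • ev (k + 1)) (ex m)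
      + t ^ (2 - 2 * u (k + 1)) *
        TT n t A (u - 2 • ev (k + 1) + ev k + ev (k + 2)) (ex m - ev (k + 1)) := by
    funext m
    exact TT_pascal n ht0 ht1 A u (ex m) k hk (ex_nonneg m) hA (ex_zero m) (ex_last m) hu
  unfold GG
  rw [this]
  exact h3.tsum_eq

lemma GG_congr (n : ℕ) {t : ℝ} (A u v : ℕ → ℤ) (h : ∀ i < n, u (i + 1) = v (i + 1))
    (hp : Even (u (n + 1) - v (n + 1))) : GG n t A u = GG n t A v := by
  unfold GG
  congr 1
  funext m
  unfold TT
  have e1 : EE n u (ex m) = EE n v (ex m) := by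
    unfold EE
    refine sum_congr rfl fun i hi => ?_
    rw [h i (by simpa using hi)]
  have e2 : ∏ i ∈ range n,
        qb2 (t ^ 4) (ex m i + ex m (i + 2) + u (i + 1) + A (i + 1)) (ex m (i + 1))
      = ∏ i ∈ range n,
        qb2 (t ^ 4) (ex m i + ex m (i + 2) + v (i + 1) + A (i + 1)) (ex m (i + 1)) := by
    refine prod_congr rfl fun i hi => ?_
    rw [h i (by simpa using hi)]
  rw [e1, e2]
  congr 2
  have : Even (ex m n + u (n + 1)) ↔ Even (ex m n + v (n + 1)) := by
    have e : ex m n + u (n + 1) = ex m n + v (n + 1) + (u (n + 1) - v (n + 1)) := by ring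
    rw [e, Int.even_add]
    simp [hp]
  simp only [this]

/-- variant of Pascal with free choice of representatives -/
lemma GG_pascal' (n : ℕ) {t : ℝ} (ht0 : 0 < t) (ht1 : t < 1) (A u v w : ℕ → ℤ) (k : ℕ)
    (hk : k < n) (hA : ∀ i, 0 ≤ A i) (c : ℤ) (hc : 1 ≤ c) (hu : u (k + 1) = c)
    (hv : ∀ i, v i = u i - 2 * ev (k + 1) i)
    (hw : ∀ i, 1 ≤ i → w i = u i - 2 * ev (k + 1) i + ev k i + ev (k + 2) i) :
    GG n t A u = GG n t A v + t ^ (2 - 2 * c) * GG n t A w := by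
  rw [GG_pascal n ht0 ht1 A u k hk hA (by omega), hu]
  congr 1
  · congr 1
    funext i
    rw [hv]; simp
  · congr 1
    apply GG_congr
    · intro i hi
      rw [hw _ (by omega)]; simp
    · rw [hw _ (by omega)]; simp

lemma ev_nonneg (j i : ℕ) : 0 ≤ ev j i := by unfold ev; split_ifs <;> omega

/-- the vector `L e_1 + e_r` -/
def uL (L : ℤ) (r : ℕ) : ℕ → ℤ := fun i => L * ev 1 i + ev r i

/-- bulk part: `S_k + R_{k+2}` is constant -/
lemma GG_tele (n : ℕ) {t : ℝ} (ht0 : 0 < t) (ht1 : t < 1) (A : ℕ → ℤ) (hA : ∀ i, 0 ≤ A i)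
    (L : ℤ) (hL : 1 ≤ L) (r : ℕ) (hr : r ≤ n + 1) (k : ℕ) (hk : k + 3 ≤ r) :
    GG n t A (fun i => (L - 1) * ev 1 i + ev (k + 1) i - ev (k + 2) i + ev r i)
      + GG n t A (fun i => (L - 1) * ev 1 i - ev (k + 2) i + ev (k + 3) i + ev r i)
    = t ^ (2 - 2 * L) * GG n t A (fun i => (L - 2) * ev 1 i + ev r i)
      + GG n t A (fun i => (L - 1) * ev 1 i - ev 1 i + ev 2 i + ev r i) := by
  induction k with
  | zero =>
    have h1 := GG_pascal' n ht0 ht1 A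
      (fun i => (L - 1) * ev 1 i + ev 1 i - ev 2 i + ev r i)
      (fun i => (L - 1) * ev 1 i - ev 1 i - ev 2 i + ev r i)
      (fun i => (L - 2) * ev 1 i + ev r i) 0 (by omega) hA L hL
      (by simp [ev]; omega) (by intro i; ring)
      (by
        intro i hi
        have h0 : ev 0 i = 0 := by (simp [ev]; omega)
        simp only [h0, zero_add]; ring)
    have h2 := GG_pascal' n ht0 ht1 A
      (fun i => (L - 1) * ev 1 i - ev 1 i + ev 2 i + ev r i)
      (fun i => (L - 1) * ev 1 i - ev 1 i - ev 2 i + ev r i)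
      (fun i => (L - 1) * ev 1 i - ev 2 i + ev 3 i + ev r i) 1 (by omega) hA 1 le_rfl
      (by simp [ev]; omega) (by intro i; ring)
      (by intro i hi; ring)
    simp only [zero_add] at *
    rw [h1, h2]
    norm_num
    ring
  | succ k ih =>
    have ih := ih (by omega)
    have h1 := GG_pascal' n ht0 ht1 A
      (fun i => (L - 1) * ev 1 i + ev (k + 2) i - ev (k + 3) i + ev r i)
      (fun i => (L - 1) * ev 1 i - ev (k + 2) i - ev (k + 3) i + ev r i)
      (fun i => (L - 1) * ev 1 i + ev (k + 1) i - ev (k + 2) i + ev r i) (k + 1) (by omega) hA 1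
      le_rfl
      (by simp [ev]; omega) (by intro i; ring)
      (by intro i hi; ring)
    have h2 := GG_pascal' n ht0 ht1 A
      (fun i => (L - 1) * ev 1 i - ev (k + 2) i + ev (k + 3) i + ev r i)
      (fun i => (L - 1) * ev 1 i - ev (k + 2) i - ev (k + 3) i + ev r i)
      (fun i => (L - 1) * ev 1 i - ev (k + 3) i + ev (k + 4) i + ev r i) (k + 2) (by omega) hA 1
      le_rfl
      (by simp [ev]; omega) (by intro i; ring)
      (by intro i hi; ring)
    rw [h2] at ih
    rw [show k + 1 + 1 = k + 2 by ring, show k + 1 + 2 = k + 3 by ring,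
      show k + 1 + 3 = k + 4 by ring]
    rw [h1, ← ih]
    norm_num
    ring

lemma GG_rec (n : ℕ) {t : ℝ} (ht0 : 0 < t) (ht1 : t < 1) (A : ℕ → ℤ) (hA : ∀ i, 0 ≤ A i)
    (L : ℤ) (hL : 1 ≤ L) (r : ℕ) (hr2 : 2 ≤ r) (hr : r ≤ n + 1) :
    GG n t A (uL L r) = (1 - t ^ (4 - 4 * L)) * GG n t A (uL (L - 2) r)
      + t ^ (2 - 2 * L) * GG n t A (uL (L - 1) (r - 1))
      + (if r ≤ n then t ^ (- 2 * L) * GG n t A (uL (L - 1) (r + 1)) else 0) := by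
  -- first step
  have h1 := GG_pascal' n ht0 ht1 A (uL L r) (uL (L - 2) r)
      (fun i => (L - 1) * ev 1 i - ev 1 i + ev 2 i + ev r i) 0 (by omega) hA L hL
      (by simp [uL, ev]; omega) (by intro i; simp only [uL]; ring)
      (by
        intro i hi
        have h0 : ev 0 i = 0 := by (simp [ev]; omega)
        simp only [uL, h0, zero_add, Nat.reduceSub]; ring)
  -- last step
  have h2 : GG n t A (fun i => (L - 1) * ev 1 i - ev (r - 1) i + ev r i + ev r i)
      = GG n t A (fun i => (L - 1) * ev 1 i - ev (r - 1) i)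
        + (if r ≤ n then t ^ (-2 : ℤ) * GG n t A (uL (L - 1) (r + 1)) else 0) := by
    split_ifs with h
    · obtain ⟨k, rfl⟩ : ∃ k, r = k + 1 := ⟨r - 1, by omega⟩
      have := GG_pascal' n ht0 ht1 A
        (fun i => (L - 1) * ev 1 i - ev (k + 1 - 1) i + ev (k + 1) i + ev (k + 1) i)
        (fun i => (L - 1) * ev 1 i - ev (k + 1 - 1) i)
        (uL (L - 1) (k + 1 + 1)) k (by omega) hA 2 (by norm_num)
        (by simp [ev]; omega) (by intro i; ring)
        (by intro i hi; simp only [uL, Nat.add_sub_cancel]; ring)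
      rw [this]; norm_num
    · have hrn : r = n + 1 := by omega
      subst hrn
      rw [add_zero]
      apply GG_congr
      · intro i hi
        simp [ev, show i ≠ n by omega]
      · simp [ev, show n ≠ 0 by omega]
  -- bulk
  have h3 : GG n t A (uL (L - 1) (r - 1))
      + GG n t A (fun i => (L - 1) * ev 1 i - ev (r - 1) i + ev r i + ev r i)
    = t ^ (2 - 2 * L) * GG n t A (uL (L - 2) r)
      + GG n t A (fun i => (L - 1) * ev 1 i - ev 1 i + ev 2 i + ev r i)
      + GG n t A (fun i => (L - 1) * ev 1 i - ev (r - 1) i) := by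
    by_cases h : r = 2
    · subst h
      have h1 := GG_pascal' n ht0 ht1 A (uL (L - 1) (2 - 1))
        (fun i => (L - 1) * ev 1 i - ev (2 - 1) i) (uL (L - 2) 2) 0 (by omega) hA L hL
        (by simp [uL, ev]) (by intro i; simp only [uL]; ring)
        (by
        intro i hi
        have h0 : ev 0 i = 0 := by (simp [ev]; omega)
        simp only [uL, h0, zero_add, Nat.reduceSub]; ring)
      rw [h1]; ring
    · obtain ⟨k, rfl⟩ : ∃ k, r = k + 3 := ⟨r - 3, by omega⟩
      have h4 := GG_tele n ht0 ht1 A hA L hL (k + 3) hr k le_rfl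
      have h5 := GG_pascal' n ht0 ht1 A (uL (L - 1) (k + 3 - 1))
        (fun i => (L - 1) * ev 1 i - ev (k + 3 - 1) i)
        (fun i => (L - 1) * ev 1 i + ev (k + 1) i - ev (k + 2) i + ev (k + 3) i)
        (k + 1) (by omega) hA 1 le_rfl
        (by simp [uL, ev]) (by intro i; simp only [uL, show k + 3 - 1 = k + 1 + 1 by omega]; ring)
        (by intro i hi; simp only [uL, show k + 3 - 1 = k + 1 + 1 by omega]; ring)
      rw [h5]
      simp only [show k + 3 - 1 = k + 2 by omega]
      have e : t ^ (2 - 2 * (1 : ℤ)) = 1 := by norm_num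
      have h4' : GG n t A (fun i => (L - 1) * ev 1 i + ev (k + 1) i - ev (k + 2) i + ev (k + 3) i)
        + GG n t A (fun i => (L - 1) * ev 1 i - ev (k + 2) i + ev (k + 3) i + ev (k + 3) i)
        = t ^ (2 - 2 * L) * GG n t A (uL (L - 2) (k + 3))
        + GG n t A (fun i => (L - 1) * ev 1 i - ev 1 i + ev 2 i + ev (k + 3) i) := h4
      rw [e]
      linarith
  have e4 : t ^ (4 - 4 * L) = t ^ (2 - 2 * L) * t ^ (2 - 2 * L) := by
    rw [← zpow_add₀ ht0.ne']; congr 1; ring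
  have e5 : (if r ≤ n then t ^ (-2 * L) * GG n t A (uL (L - 1) (r + 1)) else 0)
      = t ^ (2 - 2 * L) *
        (if r ≤ n then t ^ (-2 : ℤ) * GG n t A (uL (L - 1) (r + 1)) else 0) := by
    split_ifs
    · rw [← mul_assoc, ← zpow_add₀ ht0.ne']
      congr 2; ring
    · simp
  rw [e4, e5, h1]
  rw [h2] at h3
  have h6 : GG n t A (fun i => (L - 1) * ev 1 i - ev 1 i + ev 2 i + ev r i)
      = GG n t A (uL (L - 1) (r - 1)) - t ^ (2 - 2 * L) * GG n t A (uL (L - 2) r)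
        + (if r ≤ n then t ^ (-2 : ℤ) * GG n t A (uL (L - 1) (r + 1)) else 0) := by
    linarith
  rw [h6]; ring

lemma GG_rec_one (n : ℕ) {t : ℝ} (ht0 : 0 < t) (ht1 : t < 1) (A : ℕ → ℤ) (hA : ∀ i, 0 ≤ A i)
    (L : ℤ) (hL : 1 ≤ L) (hn : 1 ≤ n) :
    GG n t A (uL L 1) = GG n t A (uL (L - 1) 0)
      + t ^ (- 2 * L) * GG n t A (uL (L - 1) 2) := by
  have := GG_pascal' n ht0 ht1 A (uL L 1) (fun i => (L - 1) * ev 1 i)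
    (uL (L - 1) 2) 0 (by omega) hA (L + 1) (by omega)
    (by simp [uL, ev]) (by intro i; simp only [uL]; ring)
    (by
        intro i hi
        have h0 : ev 0 i = 0 := by (simp [ev]; omega)
        simp only [uL, h0, zero_add, Nat.reduceSub]; ring)
  rw [this, show (2 - 2 * (L + 1)) = -2 * L by ring]
  congr 1
  apply GG_congr
  · intro i hi; simp [uL, ev]
  · simp [uL, ev]

lemma GG_zero_node (n : ℕ) {t : ℝ} (A : ℕ → ℤ) (L : ℤ) :
    GG n t A (uL (L + 1) 0) = GG n t A (uL L 1) := by
  apply GG_congr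
  · intro i hi; simp [uL, ev]; split_ifs <;> ring
  · simp [uL, ev]
    split_ifs <;> simp

/-! ### Initial condition -/

lemma init_support (n : ℕ) (X : ℕ → ℤ) (a r : ℕ) (ha : 1 ≤ a) (han : a ≤ n) (hr : r ≤ n + 1)
    (hX : ∀ i, 0 ≤ X i) (h0 : X 0 = 0) (hn : X (n + 1) = 0)
    (hpar : Even (X n + ev r (n + 1)))
    (h : ∀ i < n, Even (X i + X (i + 2) + ev r (i + 1) + ev a (i + 1)) ∧
      2 * X (i + 1) ≤ X i + X (i + 2) + ev r (i + 1) + ev a (i + 1)) :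
    (∀ i ≤ n, X i = 0) ∧ r = a := by
  have hv : ∀ i, ∃ v : ℤ, 0 ≤ v ∧ (i < n →
      X i + X (i + 2) + ev r (i + 1) + ev a (i + 1) - 2 * X (i + 1) = 2 * v) := by
    intro i
    by_cases hi : i < n
    · obtain ⟨⟨c, hc⟩, h2⟩ := h i hi
      exact ⟨c - X (i + 1), by omega, fun _ => by omega⟩
    · exact ⟨0, le_rfl, fun h => absurd h hi⟩
  choose v hv0 hv using hv
  set V : ℕ → ℤ := fun i => ∑ j ∈ range i, v j with hV
  have Vs : ∀ i, V (i + 1) = V i + v i := fun i => sum_range_succ _ _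
  have V0 : V 0 = 0 := by simp [hV]
  have Vm : Monotone V := monotone_nat_of_le_succ fun i => by rw [Vs]; linarith [hv0 i]
  have Vn : ∀ i, 0 ≤ V i := fun i => V0 ▸ Vm (Nat.zero_le i)
  -- weighted sum
  have W : ∀ N ≤ n, ∑ i ∈ range N, ((i : ℤ) + 1) * (2 * v i)
      = N * X (N + 1) - (N + 1) * X N + (if 1 ≤ r ∧ r ≤ N then (r : ℤ) else 0)
        + (if a ≤ N then (a : ℤ) else 0) := by
    intro N
    induction N with
    | zero => intro _; simp [h0, show ¬ a = 0 by omega]; omega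
    | succ N ih =>
      intro hN
      rw [sum_range_succ, ih (by omega), ← hv N (by omega)]
      have e1 : (if 1 ≤ r ∧ r ≤ N + 1 then (r : ℤ) else 0)
          = (if 1 ≤ r ∧ r ≤ N then (r : ℤ) else 0) + (N + 1) * ev r (N + 1) := by
        unfold ev; split_ifs <;> omega
      have e2 : (if a ≤ N + 1 then (a : ℤ) else 0)
          = (if a ≤ N then (a : ℤ) else 0) + (N + 1) * ev a (N + 1) := by
        unfold ev; split_ifs <;> omega
      rw [e1, e2]; push_cast; ring
  -- slopes
  have D : ∀ N ≤ n, X (N + 1) - X N = X 1 + 2 * V N - (if 1 ≤ r ∧ r ≤ N then 1 else 0)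
        - (if a ≤ N then 1 else 0) := by
    intro N
    induction N with
    | zero => intro _; simp [h0, V0, show ¬ a = 0 by omega]; omega
    | succ N ih =>
      intro hN
      have ih := ih (by omega)
      have hvN := hv N (by omega)
      have e1 : (if 1 ≤ r ∧ r ≤ N + 1 then (1 : ℤ) else 0)
          = (if 1 ≤ r ∧ r ≤ N then (1 : ℤ) else 0) + ev r (N + 1) := by
        unfold ev; split_ifs <;> omega
      have e2 : (if a ≤ N + 1 then (1 : ℤ) else 0)
          = (if a ≤ N then (1 : ℤ) else 0) + ev a (N + 1) := by
        unfold ev; split_ifs <;> omega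
      rw [e1, e2, Vs, show N + 1 + 1 = N + 2 by ring]
      linarith
  have Wn := W n le_rfl
  have Wp : 0 ≤ ∑ i ∈ range n, ((i : ℤ) + 1) * (2 * v i) :=
    sum_nonneg fun i _ => by have := hv0 i; positivity
  rw [Wn, hn] at Wp
  simp only [han, if_true, mul_zero] at Wp
  have hXn : X n = 0 ∧ r ≤ n := by
    have := hX n
    by_cases hrn : r = n + 1
    · exfalso
      subst hrn
      simp [ev] at hpar
      simp at Wp
      obtain ⟨c, hc⟩ := hpar
      have : 1 ≤ X n := by omega
      nlinarith
    · have : ev r (n + 1) = 0 := by simp [ev]; omega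
      rw [this, add_zero] at hpar
      obtain ⟨c, hc⟩ := hpar
      refine ⟨?_, by omega⟩
      by_contra hne
      have : 2 ≤ X n := by omega
      split_ifs at Wp <;> nlinarith
  obtain ⟨hXn, hrn⟩ := hXn
  have Dn := D n le_rfl
  rw [hn, hXn] at Dn
  simp only [han, if_true, hrn, and_true] at Dn
  have hX1 := hX 1
  have hVn := Vn n
  -- nondecreasing contradiction
  have contra : X 1 = 2 ∨ (X 1 = 1 ∧ r = 0) → False := by
    intro hh
    have : ∀ N, N + 1 ≤ n → 1 ≤ X (N + 1) := by
      intro N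
      induction N with
      | zero => intro _; rw [zero_add]; omega
      | succ N ih =>
        intro hN
        have ih := ih (by omega)
        have := D (N + 1) (by omega)
        have := Vn (N + 1)
        split_ifs at * <;> omega
    have := this (n - 1) (by omega)
    rw [show n - 1 + 1 = n by omega] at this
    omega
  by_cases hr0 : r = 0
  · exfalso
    subst hr0
    simp at Dn
    exact contra (Or.inr ⟨by omega, rfl⟩)
  · rw [if_pos (by omega)] at Dn
    by_cases hV0 : V n = 0
    · exact (contra (Or.inl (by omega))).elim
    · have hV1 : V n = 1 := by omega
      have hX1 : X 1 = 0 := by omega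
      have up : ∀ i ≤ n, V i = 0 → X i ≤ 0 := by
        intro i
        induction i with
        | zero => intro _ _; omega
        | succ i ih =>
          intro hi hVi
          have h1 := Vm (Nat.le_succ i)
          have h2 := Vn i
          have h3 := ih (by omega) (by simp only [Nat.succ_eq_add_one] at h1; omega)
          have h4 := D i (by omega)
          simp only [Nat.succ_eq_add_one] at h1
          split_ifs at h4 <;> omega
      have down : ∀ d i, i + d = n → 1 ≤ V i → X i ≤ 0 := by
        intro d
        induction d with
        | zero => intro i hi _; rw [add_zero] at hi; subst hi; omega
        | succ d ih =>
          intro i hi hVi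
          have h1 := Vm (Nat.le_succ i)
          simp only [Nat.succ_eq_add_one] at h1
          have h3 := ih (i + 1) (by omega) (by omega)
          have h4 := D i (by omega)
          split_ifs at h4 <;> omega
      have hz : ∀ i ≤ n, X i = 0 := by
        intro i hi
        have := hX i
        have := Vn i
        by_cases hVi : V i = 0
        · have := up i hi hVi; omega
        · have := down (n - i) i (by omega) (by omega); omega
      refine ⟨hz, ?_⟩
      have ha' := (h (a - 1) (by omega)).1
      have hz2 : X (a - 1 + 2) = 0 := by
        by_cases hh : a = n
        · rw [show a - 1 + 2 = n + 1 by omega, hn]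
        · exact hz _ (by omega)
      rw [hz (a - 1) (by omega), hz2, show a - 1 + 1 = a by omega] at ha'
      by_contra hne
      simp [ev, show ¬ a = r by omega] at ha'

lemma ex_zero_fun {n : ℕ} (i : ℕ) : ex (0 : Fin n → ℕ) i = 0 := by
  cases i <;> simp [ex]

lemma GG_init (n : ℕ) {t : ℝ} (ht0 : 0 < t) (ht1 : t < 1) (a r : ℕ) (ha : 1 ≤ a) (han : a ≤ n)
    (hr : r ≤ n + 1) : GG n t (ev a) (uL 0 r) = if r = a then 1 else 0 := by
  have key : ∀ m : Fin n → ℕ, TT n t (ev a) (uL 0 r) (ex m) ≠ 0 → m = 0 ∧ r = a := by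
    intro m hm
    obtain ⟨h1, h2⟩ := TT_support n _ _ _ hm
    have := init_support n (ex m) a r ha han hr (ex_nonneg m) (ex_zero m) (ex_last m)
      (by simpa [uL] using h1)
      (fun i hi => by
        have := h2 i hi
        simp only [uL, zero_mul, zero_add] at this
        exact ⟨this.1, this.2.1⟩)
    refine ⟨?_, this.2⟩
    funext i
    have h3 := this.1 (i + 1) (by omega)
    simpa [ex] using h3
  unfold GG
  rw [tsum_eq_single 0]
  · split_ifs with h
    · subst h
      unfold TT
      have e : EE n (uL 0 r) (ex (0 : Fin n → ℕ)) = 0 := by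
        unfold EE; simp [ex_zero_fun]
      rw [e]
      simp only [ex_zero_fun]
      have e2 : uL 0 r (n + 1) = 0 := by simp [uL, ev]; omega
      rw [e2]
      simp
      apply prod_eq_one
      intro i hi
      have : uL 0 r (i + 1) + ev r (i + 1) = 2 * ev r (i + 1) := by simp [uL]; ring
      rw [this]
      unfold qb2
      rw [if_pos (even_two_mul _), Int.mul_ediv_cancel_left _ (by norm_num)]
      exact qb_zero_right (by positivity) (pow_lt_one₀ ht0.le ht1 (by norm_num)) (ev_nonneg _ _)
    · by_contra hne
      exact h (key 0 hne).2
  · intro m hm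
    by_contra hne
    exact hm (key m hne).1

/-! ### Bosonic side -/

/-- `q`-binomial of `L` and `(L-x)/2` -/
def qh (q : ℝ) (L x : ℤ) : ℝ := if Even (L - x) then qb q L ((L - x) / 2) else 0

lemma qh_even (q : ℝ) {L x c : ℤ} (h : L - x = 2 * c) : qh q L x = qb q L c := by
  unfold qh
  rw [h, if_pos (even_two_mul c), Int.mul_ediv_cancel_left _ (by norm_num)]

lemma qh_odd (q : ℝ) {L x : ℤ} (h : ¬ Even (L - x)) : qh q L x = 0 := by
  unfold qh; rw [if_neg h]

lemma qh_nonneg {q : ℝ} (hq0 : 0 < q) (hq1 : q < 1) (L x : ℤ) : 0 ≤ qh q L x := by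
  unfold qh; split_ifs
  · exact qb_nonneg hq0 hq1 _ _
  · exact le_rfl

lemma qh_neg (q : ℝ) (L x : ℤ) : qh q L (-x) = qh q L x := by
  by_cases h : Even (L - x)
  · obtain ⟨c, hc⟩ := h
    rw [qh_even q (show L - x = 2 * c by omega), qh_even q (show L - -x = 2 * (L - c) by omega),
      qb_symm]
  · rw [qh_odd q h, qh_odd q]
    intro h'; apply h
    obtain ⟨c, hc⟩ := h'
    exact ⟨L - c, by omega⟩

lemma qh_ne_zero {q : ℝ} {L x : ℤ} (h : qh q L x ≠ 0) : -L ≤ x ∧ x ≤ L := by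
  by_cases he : Even (L - x)
  · obtain ⟨c, hc⟩ := he
    rw [qh_even q (show L - x = 2 * c by omega)] at h
    unfold qb at h
    split_ifs at h with h1
    · omega
    · exact absurd rfl h
  · exact absurd (qh_odd q he) h

lemma qh_rec {q : ℝ} (hq0 : 0 < q) (hq1 : q < 1) {L : ℤ} (hL : 0 ≤ L) (x : ℤ) :
    qh q (L + 2) x = (q ^ (L + 1) - 1) * qh q L x + qh q (L + 1) (x - 1) + qh q (L + 1) (x + 1) := by
  by_cases h : Even (L - x)
  · obtain ⟨c, hc⟩ := h
    rw [qh_even q (show L + 2 - x = 2 * (c + 1) by omega), qh_even q (show L - x = 2 * c by omega),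
      qh_even q (show L + 1 - (x - 1) = 2 * (c + 1) by omega),
      qh_even q (show L + 1 - (x + 1) = 2 * c by omega), qb_rec hq0 hq1 hL]
    simp
  · have h2 : ∀ y, (L - x) % 2 = y % 2 → ¬ Even y := by
      intro y hy; rw [Int.even_iff] at *; omega
    rw [qh_odd q h, qh_odd q (h2 _ (by omega)), qh_odd q (h2 _ (by omega)),
      qh_odd q (h2 _ (by omega))]
    simp

lemma qh_zero_left {q : ℝ} (hq0 : 0 < q) (hq1 : q < 1) (x : ℤ) :
    qh q 0 x = if x = 0 then 1 else 0 := by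
  split_ifs with h
  · subst h
    rw [qh_even q (show (0:ℤ) - 0 = 2 * 0 by norm_num), qb_zero_right hq0 hq1 le_rfl]
  · by_contra hne
    have := qh_ne_zero hne
    omega

lemma qh_one {q : ℝ} (hq0 : 0 < q) (hq1 : q < 1) (x : ℤ) :
    qh q 1 x = qh q 0 (x - 1) + qh q 0 (x + 1) := by
  rw [qh_zero_left hq0 hq1, qh_zero_left hq0 hq1]
  by_cases h1 : x = 1
  · subst h1
    rw [qh_even q (show (1:ℤ) - 1 = 2 * 0 by norm_num), qb_zero_right hq0 hq1 (by norm_num)]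
    norm_num
  · by_cases h2 : x = -1
    · subst h2
      rw [qh_even q (show (1:ℤ) - -1 = 2 * 1 by norm_num), qb_self hq0 hq1 (by norm_num)]
      norm_num
    · rw [if_neg (by omega), if_neg (by omega), add_zero]
      by_contra hne
      have h3 := qh_ne_zero hne
      have : x = 0 := by omega
      subst this
      exact hne (qh_odd q (by decide))

/-- the difference `w(x) = qh(L+1,x) - qh(L,x+1)` -/
def qw (q : ℝ) (L x : ℤ) : ℝ := qh q (L + 1) x - qh q L (x + 1)

lemma qw_refl {q : ℝ} (hq0 : 0 < q) (hq1 : q < 1) {L : ℤ} (hL : 0 ≤ L) (x : ℤ) :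
    qw q L (2 - x) = q ^ (x - 1) * qw q L x := by
  unfold qw
  by_cases h : Even (L + 1 - x)
  · obtain ⟨c, hc⟩ := h
    rw [qh_even q (show L + 1 - (2 - x) = 2 * (L - c) by omega),
      qh_even q (show L - (2 - x + 1) = 2 * (L - c - 1) by omega),
      qh_even q (show L + 1 - x = 2 * c by omega),
      qh_even q (show L - (x + 1) = 2 * (c - 1) by omega),
      qb_pascal hq0 hq1 (show 1 ≤ L + 1 by omega) c,
      qb_pascal hq0 hq1 (show 1 ≤ L + 1 by omega) (L - c)]
    simp only [add_sub_cancel_right, qb_symm]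
    rw [← mul_assoc, ← zpow_add₀ hq0.ne']
    congr 2; omega
  · have h2 : ∀ y, (L + 1 - x) % 2 = y % 2 → ¬ Even y := by
      intro y hy; rw [Int.even_iff] at *; omega
    rw [qh_odd q h, qh_odd q (h2 _ (by omega)), qh_odd q (h2 _ (by omega)),
      qh_odd q (h2 _ (by omega))]
    simp

def gam (q : ℝ) (p a j : ℤ) : ℝ := q ^ (p * j * (j - 1) + a * j)

lemma gam_pos {q : ℝ} (hq0 : 0 < q) (p a j : ℤ) : 0 < gam q p a j := zpow_pos hq0 _

lemma gam_succ {q : ℝ} (hq0 : 0 < q) (p a j : ℤ) :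
    gam q p a (j + 1) = gam q p a j * q ^ (2 * p * j + a) := by
  unfold gam
  rw [← zpow_add₀ hq0.ne']; congr 1; ring

def bt (q : ℝ) (p a r L j : ℤ) : ℝ :=
  gam q p a j * (qh q L (r - (a - 1) - 2 * p * j) - qh q L (r + a + 1 + 2 * p * (j - 1)))

def bo (q : ℝ) (p a r L : ℤ) : ℝ := ∑' j : ℤ, bt q p a r L j

lemma fin_set (p c L : ℤ) (hp : 1 ≤ p) (j : ℤ) (h1 : -L ≤ c + 2 * p * j) (h2 : c + 2 * p * j ≤ L) :
    j ∈ Set.Icc (-(|c| + |L|)) (|c| + |L|) := by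
  have := neg_abs_le c
  have := le_abs_self c
  have := le_abs_self L
  have h4 := abs_nonneg c
  have h5 := abs_nonneg L
  constructor
  · by_contra hh
    have : p * j ≤ 1 * j := by nlinarith
    nlinarith
  · by_contra hh
    have : 1 * j ≤ p * j := by nlinarith
    nlinarith

lemma qh_finite (q : ℝ) (p c L : ℤ) (hp : 1 ≤ p) :
    (Function.support fun j : ℤ => qh q L (c + 2 * p * j)).Finite := by
  refine (Set.finite_Icc (-(|c| + |L|)) (|c| + |L|)).subset ?_
  intro j hj
  have := qh_ne_zero hj
  exact fin_set p c L hp j this.1 this.2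

lemma qh_gam_summable (q : ℝ) (p a c L : ℤ) (hp : 1 ≤ p) :
    Summable fun j : ℤ => gam q p a j * qh q L (c + 2 * p * j) := by
  apply summable_of_hasFiniteSupport
  refine (qh_finite q p c L hp).subset ?_
  intro j hj
  exact right_ne_zero_of_mul hj

lemma qh_gam_summable' (q : ℝ) (p a c L : ℤ) (hp : 1 ≤ p) :
    Summable fun j : ℤ => gam q p a j * qh q L (c - 2 * p * j) := by
  have := qh_gam_summable q p a (-c) L hp
  refine this.congr fun j => ?_
  rw [← qh_neg]; congr 2; ring

lemma bt_summable1 (q : ℝ) (p a r L : ℤ) (hp : 1 ≤ p) :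
    Summable fun j : ℤ => gam q p a j * qh q L (r - (a - 1) - 2 * p * j) :=
  qh_gam_summable' q p a (r - (a - 1)) L hp

lemma bt_summable2 (q : ℝ) (p a r L : ℤ) (hp : 1 ≤ p) :
    Summable fun j : ℤ => gam q p a j * qh q L (r + a + 1 + 2 * p * (j - 1)) := by
  refine (qh_gam_summable q p a (r + a + 1 - 2 * p) L hp).congr fun j => ?_
  congr 2; ring

lemma bo_hasSum (q : ℝ) (p a r L : ℤ) (hp : 1 ≤ p) : HasSum (bt q p a r L) (bo q p a r L) := by
  apply Summable.hasSum
  refine ((bt_summable1 q p a r L hp).sub (bt_summable2 q p a r L hp)).congr fun j => ?_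
  unfold bt; ring

lemma bo_rec {q : ℝ} (hq0 : 0 < q) (hq1 : q < 1) (p a r : ℤ) (hp : 1 ≤ p) {L : ℤ} (hL : 0 ≤ L) :
    bo q p a r (L + 2) = (q ^ (L + 1) - 1) * bo q p a r L + bo q p a (r - 1) (L + 1)
      + bo q p a (r + 1) (L + 1) := by
  have h1 := (((bo_hasSum q p a r L hp).mul_left (q ^ (L + 1) - 1)).add
    (bo_hasSum q p a (r - 1) (L + 1) hp)).add (bo_hasSum q p a (r + 1) (L + 1) hp)
  refine (bo_hasSum q p a r (L + 2) hp).unique (h1.congr_fun ?_)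
  intro j
  unfold bt
  rw [qh_rec hq0 hq1 hL, qh_rec hq0 hq1 hL]
  rw [show r - (a - 1) - 2 * p * j - 1 = r - 1 - (a - 1) - 2 * p * j by ring,
    show r - (a - 1) - 2 * p * j + 1 = r + 1 - (a - 1) - 2 * p * j by ring,
    show r + a + 1 + 2 * p * (j - 1) - 1 = r - 1 + a + 1 + 2 * p * (j - 1) by ring,
    show r + a + 1 + 2 * p * (j - 1) + 1 = r + 1 + a + 1 + 2 * p * (j - 1) by ring]
  ring

lemma bo_one {q : ℝ} (hq0 : 0 < q) (hq1 : q < 1) (p a r : ℤ) (hp : 1 ≤ p) :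
    bo q p a r 1 = bo q p a (r - 1) 0 + bo q p a (r + 1) 0 := by
  have h1 := (bo_hasSum q p a (r - 1) 0 hp).add (bo_hasSum q p a (r + 1) 0 hp)
  refine (bo_hasSum q p a r 1 hp).unique (h1.congr_fun ?_)
  intro j
  unfold bt
  rw [qh_one hq0 hq1, qh_one hq0 hq1]
  rw [show r - (a - 1) - 2 * p * j - 1 = r - 1 - (a - 1) - 2 * p * j by ring,
    show r - (a - 1) - 2 * p * j + 1 = r + 1 - (a - 1) - 2 * p * j by ring,
    show r + a + 1 + 2 * p * (j - 1) - 1 = r - 1 + a + 1 + 2 * p * (j - 1) by ring,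
    show r + a + 1 + 2 * p * (j - 1) + 1 = r + 1 + a + 1 + 2 * p * (j - 1) by ring]
  ring

lemma bo_top (q : ℝ) (p a L : ℤ) : bo q p a (p - 1) L = 0 := by
  unfold bo
  rw [← tsum_zero (α := ℝ) (β := ℤ)]
  congr 1
  funext j
  unfold bt
  rw [← qh_neg q L (p - 1 - (a - 1) - 2 * p * j)]
  rw [show -(p - 1 - (a - 1) - 2 * p * j) = p - 1 + a + 1 + 2 * p * (j - 1) by ring]
  ring

lemma bo_zero_node {q : ℝ} (hq0 : 0 < q) (hq1 : q < 1) (p a : ℤ) (hp : 1 ≤ p) {L : ℤ}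
    (hL : 0 ≤ L) : bo q p a 0 (L + 1) = bo q p a 1 L := by
  have s : HasSum (fun j => gam q p a j * qw q L (a + 1 + 2 * p * (j - 1)))
      (∑' j, gam q p a j * qw q L (a + 1 + 2 * p * (j - 1))) := by
    apply Summable.hasSum
    refine ((bt_summable2 q p a 0 (L + 1) hp).sub (bt_summable2 q p a 1 L hp)).congr fun j => ?_
    unfold qw
    rw [show 0 + a + 1 + 2 * p * (j - 1) = a + 1 + 2 * p * (j - 1) by ring,
      show 1 + a + 1 + 2 * p * (j - 1) = a + 1 + 2 * p * (j - 1) + 1 by ring]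
    ring
  have s' : HasSum (fun j => gam q p a j * qw q L (1 - a - 2 * p * j))
      (∑' j, gam q p a j * qw q L (a + 1 + 2 * p * (j - 1))) := by
    have := (Equiv.addRight (1 : ℤ)).hasSum_iff.mpr s
    refine this.congr_fun fun j => ?_
    simp only [Function.comp, Equiv.coe_addRight]
    rw [gam_succ hq0, show (1 - a - 2 * p * j) = 2 - (a + 1 + 2 * p * (j + 1 - 1)) by ring,
      qw_refl hq0 hq1 hL]
    rw [show a + 1 + 2 * p * (j + 1 - 1) - 1 = 2 * p * j + a by ring]
    ring
  have h1 := (bo_hasSum q p a 0 (L + 1) hp).sub (bo_hasSum q p a 1 L hp)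
  have h2 := s'.sub s
  have := h1.unique (h2.congr_fun ?_)
  · linarith
  · intro j
    unfold bt qw
    rw [show 0 - (a - 1) - 2 * p * j = 1 - a - 2 * p * j by ring,
      show 1 - (a - 1) - 2 * p * j = 1 - a - 2 * p * j + 1 by ring,
      show 0 + a + 1 + 2 * p * (j - 1) = a + 1 + 2 * p * (j - 1) by ring,
      show 1 + a + 1 + 2 * p * (j - 1) = a + 1 + 2 * p * (j - 1) + 1 by ring]
    ring

lemma bo_init {q : ℝ} (hq0 : 0 < q) (hq1 : q < 1) (p a r : ℤ) (hr0 : 0 ≤ r) (hr : r ≤ p - 2)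
    (ha : 2 ≤ a) (hap : a ≤ p - 2) : bo q p a r 0 = if r = a - 1 then 1 else 0 := by
  unfold bo
  rw [tsum_eq_single 0]
  · unfold bt gam
    rw [qh_zero_left hq0 hq1, qh_zero_left hq0 hq1]
    rw [if_neg (show ¬ r + a + 1 + 2 * p * (0 - 1) = 0 by linarith)]
    simp only [mul_zero, sub_zero, zero_mul, add_zero, zpow_zero, one_mul]
    by_cases h : r = a - 1
    · rw [if_pos h, if_pos (by omega)]
    · rw [if_neg h, if_neg (by omega)]
  · intro j hj
    unfold bt
    rw [qh_zero_left hq0 hq1, qh_zero_left hq0 hq1]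
    rw [if_neg, if_neg]
    · simp
    · intro h
      rcases lt_or_gt_of_ne hj with h1 | h1
      · have : p * j ≤ p * (-1) := by nlinarith
        nlinarith
      · rcases lt_or_ge j 2 with h2 | h2
        · have : j = 1 := by omega
          subst this; linarith
        · have : p * 2 ≤ p * j := by nlinarith
          nlinarith
    · intro h
      rcases lt_or_gt_of_ne hj with h1 | h1
      · have : p * j ≤ p * (-1) := by nlinarith
        nlinarith
      · have : p * 1 ≤ p * j := by nlinarith
        nlinarith

/-- fermionic = bosonic -/
lemma GG_eq_bo (n : ℕ) {t : ℝ} (ht0 : 0 < t) (ht1 : t < 1) (a : ℕ) (ha : 1 ≤ a) (han : a ≤ n)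
    (L : ℕ) : ∀ r : ℕ, 1 ≤ r → r ≤ n + 1 → GG n t (ev a) (uL L r) =
      t ^ ((r : ℤ) - (L : ℤ) ^ 2 - a) * bo (t ^ 4) (n + 3) (a + 1) r L := by
  have hq0 : 0 < t ^ 4 := by positivity
  have hq1 : t ^ 4 < 1 := pow_lt_one₀ ht0.le ht1 (by norm_num)
  have hp : (1 : ℤ) ≤ n + 3 := by omega
  have hA := ev_nonneg a
  have htop : ∀ (L : ℤ) (r : ℕ), r = n + 2 → bo (t ^ 4) (n + 3) (a + 1) r L = 0 := by
    intro L r hr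
    have := bo_top (t ^ 4) (n + 3) (a + 1) L
    rw [← this]; congr 1; rw [hr]; push_cast; ring
  have P0 : ∀ r : ℕ, r ≤ n + 1 → GG n t (ev a) (uL 0 r) =
      t ^ ((r : ℤ) - a) * bo (t ^ 4) (n + 3) (a + 1) r 0 := by
    intro r hr
    rw [GG_init n ht0 ht1 a r ha han hr, bo_init hq0 hq1 _ _ _ (by omega) (by omega) (by omega)
      (by omega)]
    by_cases h : r = a
    · subst h; simp
    · rw [if_neg h, if_neg (by omega), mul_zero]
  have em : ∀ x y : ℤ, t ^ (x + y) = t ^ x * t ^ y := fun x y => zpow_add₀ ht0.ne' x y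
  have e4 : ∀ x : ℤ, (t ^ 4) ^ x = t ^ (4 * x) := fun x => by
    rw [zpow_mul]; norm_cast
  induction L using Nat.twoStepInduction with
  | zero =>
    intro r hr1 hr
    have := P0 r hr
    simpa using this
  | one =>
    intro r hr1 hr
    have hb := bo_one hq0 hq1 (n + 3) (a + 1) r hp
    simp only [Nat.cast_one]
    rw [hb]
    by_cases h : r = 1
    · subst h
      rw [GG_rec_one n ht0 ht1 _ hA 1 le_rfl (by omega)]
      simp only [sub_self]
      rw [P0 0 (by omega), P0 2 (by omega)]
      have h0 : bo (t ^ 4) (n + 3) (a + 1) ((0 : ℕ) : ℤ) 0 = 0 := by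
        rw [bo_init hq0 hq1 _ _ _ (by simp) (by omega) (by omega) (by omega), if_neg]
        omega
      rw [h0]
      simp only [Nat.cast_zero] at h0
      simp only [Nat.cast_one, sub_self, h0, Nat.cast_ofNat]
      rw [← mul_assoc, ← em, show -2 * (1 : ℤ) + (2 - a) = -a by ring]
      norm_num
    · rw [GG_rec n ht0 ht1 _ hA 1 le_rfl r (by omega) hr]
      norm_num
      rw [P0 (r - 1) (by omega), show ((r - 1 : ℕ) : ℤ) = r - 1 by omega]
      have e : (r : ℤ) - 1 - a = (r : ℤ) - 1 - a := rfl
      by_cases hrn : r ≤ n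
      · rw [if_pos hrn, P0 (r + 1) (by omega)]
        rw [show ((r + 1 : ℕ) : ℤ) - a = (r - 1 - a) + 2 by push_cast; ring, em]
        push_cast
        have : t ^ (2 : ℤ) ≠ 0 := by positivity
        norm_cast at *
        field_simp
      · rw [if_neg hrn]
        have := htop 0 (r + 1) (by omega)
        push_cast at this
        rw [this]; ring
  | more L ih0 ih1 =>
    intro r hr1 hr
    have hb := bo_rec hq0 hq1 (n + 3) (a + 1) r hp (show (0 : ℤ) ≤ L by omega)
    push_cast at *
    rw [hb, e4]
    by_cases h : r = 1
    · subst h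
      rw [GG_rec_one n ht0 ht1 _ hA (L + 2) (by omega) (by omega)]
      rw [show (L : ℤ) + 2 - 1 = L + 1 by ring, GG_zero_node, ih0 1 le_rfl (by omega)]
      have := ih1 2 (by omega) (by omega)
      push_cast at this
      rw [this]
      simp only [Nat.cast_one, sub_self, show (1 : ℤ) + 1 = 2 by norm_num]
      rw [bo_zero_node hq0 hq1 _ _ hp (by omega)]
      rw [show (1 : ℤ) - L ^ 2 - a = (1 - ((L : ℤ) + 2) ^ 2 - a) + 4 * (L + 1) by ring,
        ← mul_assoc (t ^ (-2 * ((L : ℤ) + 2))), ← em]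
      rw [show -2 * ((L : ℤ) + 2) + (2 - (L + 1) ^ 2 - a) = 1 - ((L : ℤ) + 2) ^ 2 - a by ring, em]
      ring
    · rw [GG_rec n ht0 ht1 _ hA (L + 2) (by omega) r (by omega) hr]
      rw [show (L : ℤ) + 2 - 2 = L by ring, show (L : ℤ) + 2 - 1 = L + 1 by ring,
        ih0 r hr1 hr, ih1 (r - 1) (by omega) (by omega), show ((r - 1 : ℕ) : ℤ) = r - 1 by omega]
      have e3 : (if r ≤ n then t ^ (-2 * ((L : ℤ) + 2)) * GG n t (ev a) (uL (L + 1) (r + 1)) else 0)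
          = t ^ ((r : ℤ) - (L + 2) ^ 2 - a) * bo (t ^ 4) (n + 3) (a + 1) (r + 1) (L + 1) := by
        split_ifs with hrn
        · have := ih1 (r + 1) (by omega) (by omega)
          push_cast at this
          rw [this, ← mul_assoc, ← em]
          congr 2; ring
        · have := htop (L + 1) (r + 1) (by omega)
          push_cast at this
          rw [this]; ring
      rw [e3, ← mul_assoc (t ^ (2 - 2 * ((L : ℤ) + 2))), ← em]
      rw [show 2 - 2 * ((L : ℤ) + 2) + ((r : ℤ) - 1 - (L + 1) ^ 2 - a) = r - (L + 2) ^ 2 - a by ring]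
      have e5 : (1 - t ^ (4 - 4 * ((L : ℤ) + 2))) * (t ^ ((r : ℤ) - (L : ℤ) ^ 2 - a) *
          bo (t ^ 4) (n + 3) (a + 1) r L) = t ^ ((r : ℤ) - (L + 2) ^ 2 - a) *
          ((t ^ (4 * ((L : ℤ) + 1)) - 1) * bo (t ^ 4) (n + 3) (a + 1) r L) := by
        rw [← mul_assoc, ← mul_assoc, sub_mul, mul_sub, ← em, ← em, one_mul, mul_one]
        congr 3 <;> ring
      rw [e5]; ring

/-! ### `q`-series -/

lemma poch_tendsto {q : ℝ} (hq0 : 0 < q) (hq1 : q < 1) :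
    Filter.Tendsto (qPoch q) Filter.atTop (nhds (qPochInf q)) := by
  have hs : Summable fun j : ℕ => -(q ^ (j + 1)) :=
    (((summable_geometric_of_lt_one hq0.le hq1).mul_left q).congr fun j => by ring).neg
  have hm := Real.multipliable_one_add_of_summable hs
  have h := hm.hasProd.tendsto_prod_nat
  simp only [← sub_eq_add_neg] at h
  exact h

lemma pochInf_pos {q : ℝ} (hq0 : 0 < q) (hq1 : q < 1) : 0 < qPochInf q := by
  have hs : Summable fun j : ℕ => -(q ^ (j + 1)) :=
    (((summable_geometric_of_lt_one hq0.le hq1).mul_left q).congr fun j => by ring).neg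
  have h := Real.rexp_tsum_eq_tprod (f := fun j : ℕ => 1 - q ^ (j + 1))
    (fun j => by
      have : q ^ (j + 1) < 1 := pow_lt_one₀ hq0.le hq1 (by omega)
      linarith)
    ((Real.summable_log_one_add_of_summable hs).congr fun j => by rw [← sub_eq_add_neg])
  unfold qPochInf
  rw [← h]; exact Real.exp_pos _

lemma pochInf_le {q : ℝ} (hq0 : 0 < q) (hq1 : q < 1) (k : ℕ) : qPochInf q ≤ qPoch q k := by
  have : Antitone (qPoch q) := antitone_nat_of_succ_le fun n => by
    rw [qPoch_succ]
    have h1 := qPoch_pos hq0 hq1 n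
    have h2 : 0 < q ^ (n + 1) := by positivity
    nlinarith
  exact this.le_of_tendsto (poch_tendsto hq0 hq1) k

/-- terms of the Durfee-type sums -/
def sT (q : ℝ) (k n : ℕ) : ℝ := q ^ (n * (n + k)) / (qPoch q n * qPoch q (n + k))

def dT (q : ℝ) (k n : ℕ) : ℝ := q ^ (n * (n + k)) * (q ^ n)⁻¹ / (qPoch q n * qPoch q (n + k))

lemma sT_nonneg {q : ℝ} (hq0 : 0 < q) (hq1 : q < 1) (k n : ℕ) : 0 ≤ sT q k n := by
  have h1 := qPoch_pos hq0 hq1 n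
  have h2 := qPoch_pos hq0 hq1 (n + k)
  unfold sT; positivity

lemma sT_le {q : ℝ} (hq0 : 0 < q) (hq1 : q < 1) (k n : ℕ) :
    sT q k n ≤ q ^ (n * (n + k)) * (1 / qPochInf q ^ 2) := by
  have h1 := pochInf_le hq0 hq1 n
  have h2 := pochInf_le hq0 hq1 (n + k)
  have h3 := pochInf_pos hq0 hq1
  unfold sT
  rw [mul_one_div]
  gcongr
  rw [sq]
  exact mul_le_mul h1 h2 h3.le (h3.le.trans h1)

lemma sT_le' {q : ℝ} (hq0 : 0 < q) (hq1 : q < 1) (k n : ℕ) :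
    sT q k n ≤ q ^ n * (1 / qPochInf q ^ 2) := by
  refine (sT_le hq0 hq1 k n).trans ?_
  have h3 := pochInf_pos hq0 hq1
  have : q ^ (n * (n + k)) ≤ q ^ n := pow_le_pow_of_le_one hq0.le hq1.le (by nlinarith [Nat.zero_le (n*k), Nat.le_self_pow (show 2 ≠ 0 by norm_num) n])
  gcongr

lemma sT_summable {q : ℝ} (hq0 : 0 < q) (hq1 : q < 1) (k : ℕ) : Summable (sT q k) :=
  Summable.of_nonneg_of_le (sT_nonneg hq0 hq1 k) (sT_le' hq0 hq1 k)
    ((summable_geometric_of_lt_one hq0.le hq1).mul_right _)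

lemma dT_hasSum {q : ℝ} (hq0 : 0 < q) (hq1 : q < 1) (k : ℕ) :
    HasSum (dT q k) (∑' n, sT q k n + q ^ k * ∑' n, sT q (k + 1) n) := by
  have h1 := (sT_summable hq0 hq1 k).hasSum
  have h2 : HasSum (fun n => (1 - q ^ n) * dT q k n) (q ^ k * ∑' n, sT q (k + 1) n) := by
    rw [← hasSum_nat_add_iff' 1]
    simp only [range_one, sum_singleton, pow_zero, sub_self, zero_mul, sub_zero]
    refine ((sT_summable hq0 hq1 (k + 1)).hasSum.mul_left (q ^ k)).congr_fun fun m => ?_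
    unfold dT sT
    rw [qPoch_succ, show m + 1 + k = m + (k + 1) by ring]
    have h3 := (qPoch_pos hq0 hq1 m).ne'
    have h4 := (qPoch_pos hq0 hq1 (m + (k + 1))).ne'
    have h5 : 1 - q ^ (m + 1) ≠ 0 := by
      have : q ^ (m + 1) < 1 := pow_lt_one₀ hq0.le hq1 (by omega)
      linarith
    have h6 : q ^ (m + 1) ≠ 0 := by positivity
    have h7 : q ^ ((m + 1) * (m + (k + 1))) = q ^ k * q ^ (m * (m + (k + 1))) * q ^ (m + 1) := by
      rw [← pow_add, ← pow_add]; congr 1; ring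
    rw [h7]
    field_simp
  refine (h1.add h2).congr_fun fun n => ?_
  have h6 : q ^ n ≠ 0 := by positivity
  have : sT q k n = q ^ n * dT q k n := by
    unfold sT dT; field_simp
  rw [this]; ring

lemma dT_hasSum' {q : ℝ} (hq0 : 0 < q) (hq1 : q < 1) (k : ℕ) :
    HasSum (dT q (k + 1)) (∑' n, sT q k n + q ^ (k + 1) * ∑' n, sT q (k + 1) n) := by
  have h1 := (sT_summable hq0 hq1 k).hasSum
  have h2 := (sT_summable hq0 hq1 (k + 1)).hasSum.mul_left (q ^ (k + 1))
  refine (h1.add h2).congr_fun fun n => ?_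
  unfold sT dT
  rw [show n + (k + 1) = n + k + 1 by ring, qPoch_succ]
  have h3 := (qPoch_pos hq0 hq1 n).ne'
  have h4 := (qPoch_pos hq0 hq1 (n + k)).ne'
  have h5 : 1 - q ^ (n + k + 1) ≠ 0 := by
    have : q ^ (n + k + 1) < 1 := pow_lt_one₀ hq0.le hq1 (by omega)
    linarith
  have h6 : q ^ n ≠ 0 := by positivity
  have h7 : q ^ (n * (n + k + 1)) = q ^ (n * (n + k)) * q ^ n := by
    rw [← pow_add]; congr 1
  have h8 : q ^ (n + k + 1) = q ^ n * q ^ (k + 1) := by rw [← pow_add]; congr 1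
  rw [h7]
  rw [h8] at h5 ⊢
  generalize q ^ n = x at *
  generalize q ^ (k + 1) = y at *
  field_simp
  ring

lemma sT_sum_eq {q : ℝ} (hq0 : 0 < q) (hq1 : q < 1) (k : ℕ) :
    ∑' n, sT q k n = ∑' n, sT q (k + 1) n := by
  set S : ℕ → ℝ := fun k => ∑' n, sT q k n with hS
  have hrec : ∀ k, S k - S (k + 1) = -(q ^ (k + 1) * (S (k + 1) - S (k + 2))) := by
    intro k
    have h1 := (dT_hasSum hq0 hq1 (k + 1)).unique (dT_hasSum' hq0 hq1 k)
    simp only [hS]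
    rw [show k + 1 + 1 = k + 2 by ring] at h1
    linarith
  set M : ℝ := ∑' n, q ^ n * (1 / qPochInf q ^ 2) with hM
  have hb : ∀ k, S k ≤ M := fun k =>
    (sT_summable hq0 hq1 k).tsum_le_tsum (sT_le' hq0 hq1 k)
      ((summable_geometric_of_lt_one hq0.le hq1).mul_right _)
  have hn : ∀ k, 0 ≤ S k := fun k => tsum_nonneg (sT_nonneg hq0 hq1 k)
  have hd : ∀ k, |S k - S (k + 1)| ≤ M := by
    intro k
    have := hb k
    have := hb (k + 1)
    have := hn k
    have := hn (k + 1)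
    rw [abs_le]; constructor <;> linarith
  have hstep : ∀ N k, |S k - S (k + 1)| ≤ q ^ N * M := by
    intro N
    induction N with
    | zero => intro k; simpa using hd k
    | succ N ih =>
      intro k
      rw [hrec, abs_neg, abs_mul, abs_of_pos (by positivity)]
      have h1 := ih (k + 1)
      have h2 : q ^ (k + 1) ≤ q := by
        have := pow_le_pow_of_le_one hq0.le hq1.le (show 1 ≤ k + 1 by omega)
        simpa using this
      calc q ^ (k + 1) * |S (k + 1) - S (k + 2)| ≤ q * (q ^ N * M) := by gcongr
        _ = _ := by ring
  have hlim : Filter.Tendsto (fun N : ℕ => q ^ N * M) Filter.atTop (nhds 0) := by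
    simpa using (tendsto_pow_atTop_nhds_zero_of_lt_one hq0.le hq1).mul_const M
  have h0 : |S k - S (k + 1)| ≤ 0 := ge_of_tendsto' hlim fun N => hstep N k
  have := abs_nonpos_iff.mp h0
  simp only [hS] at this
  linarith

lemma sT_sum {q : ℝ} (hq0 : 0 < q) (hq1 : q < 1) (k : ℕ) :
    ∑' n, sT q k n = 1 / qPochInf q := by
  have hc : ∀ k, ∑' n, sT q k n = ∑' n, sT q 0 n := by
    intro k
    induction k with
    | zero => rfl
    | succ k ih => rw [← sT_sum_eq hq0 hq1, ih]
  have hpos := pochInf_pos hq0 hq1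
  have hlim : Filter.Tendsto (fun k => ∑' n, sT q k n) Filter.atTop
      (nhds (∑' n : ℕ, if n = 0 then 1 / qPochInf q else 0)) := by
    refine tendsto_tsum_of_dominated_convergence (bound := fun n => q ^ n * (1 / qPochInf q ^ 2))
      ((summable_geometric_of_lt_one hq0.le hq1).mul_right _) ?_ ?_
    · intro n
      split_ifs with h
      · subst h
        have : (fun k => sT q k 0) = fun k => 1 / qPoch q k := by
          funext k; simp [sT, qPoch_zero]
        rw [this]
        exact tendsto_const_nhds.div (poch_tendsto hq0 hq1) hpos.ne'
      · refine squeeze_zero (fun k => sT_nonneg hq0 hq1 k n)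
          (g := fun k => q ^ k * (1 / qPochInf q ^ 2)) (fun k => ?_) ?_
        · refine (sT_le hq0 hq1 k n).trans ?_
          have : q ^ (n * (n + k)) ≤ q ^ k :=
            pow_le_pow_of_le_one hq0.le hq1.le (by
              have : 1 ≤ n := by omega
              nlinarith)
          gcongr
        · have := (tendsto_pow_atTop_nhds_zero_of_lt_one hq0.le hq1).mul_const
            (1 / qPochInf q ^ 2)
          rwa [zero_mul] at this
    · filter_upwards with k n
      rw [Real.norm_of_nonneg (sT_nonneg hq0 hq1 k n)]
      exact sT_le' hq0 hq1 k n
  rw [tsum_ite_eq] at hlim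
  have : (fun k => ∑' n, sT q k n) = fun _ => ∑' n, sT q 0 n := funext hc
  rw [this] at hlim
  rw [hc]
  exact tendsto_nhds_unique tendsto_const_nhds hlim

lemma dT_sum {q : ℝ} (hq0 : 0 < q) (hq1 : q < 1) (k : ℕ) :
    HasSum (dT q k) ((1 + q ^ k) / qPochInf q) := by
  have := dT_hasSum hq0 hq1 k
  rw [sT_sum hq0 hq1, sT_sum hq0 hq1] at this
  convert this using 1; ring

lemma Lsum_nat {t : ℝ} (ht0 : 0 < t) (ht1 : t < 1) (k : ℕ) :
    HasSum (fun L : ℕ => t ^ ((L : ℤ) ^ 2 - 2 * L) * qh (t ^ 4) L k / qPoch (t ^ 4) L)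
      (t ^ ((k : ℤ) ^ 2) * (t ^ (2 * (k : ℤ)) + t ^ (-2 * (k : ℤ))) / qPochInf (t ^ 4)) := by
  have hq0 : 0 < t ^ 4 := by positivity
  have hq1 : t ^ 4 < 1 := pow_lt_one₀ ht0.le ht1 (by norm_num)
  have em : ∀ x y : ℤ, t ^ (x + y) = t ^ x * t ^ y := fun x y => zpow_add₀ ht0.ne' x y
  have hinj : Function.Injective (fun n : ℕ => 2 * n + k) := fun x y h => by
    simp only at h; omega
  rw [← hinj.hasSum_iff]
  · have h := (dT_sum hq0 hq1 k).mul_left (t ^ ((k : ℤ) ^ 2 - 2 * k))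
    have e : t ^ ((k : ℤ) ^ 2 - 2 * k) * ((1 + (t ^ 4) ^ k) / qPochInf (t ^ 4))
        = t ^ ((k : ℤ) ^ 2) * (t ^ (2 * (k : ℤ)) + t ^ (-2 * (k : ℤ))) / qPochInf (t ^ 4) := by
      rw [← mul_div_assoc, mul_add, mul_add, mul_one, ← pow_mul, ← zpow_natCast t (4 * k), ← em,
        ← em, ← em, add_comm]
      congr 3 <;> (push_cast; ring_nf)
    rw [← e]
    refine h.congr_fun fun n => ?_
    simp only [Function.comp]
    rw [qh_even _ (show ((2 * n + k : ℕ) : ℤ) - k = 2 * n by push_cast; ring),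
      show ((2 * n + k : ℕ) : ℤ) = (n : ℤ) + ((n + k : ℕ) : ℤ) by push_cast; ring, qb_nat,
      show n + (n + k) = 2 * n + k by ring]
    unfold dT
    have h1 := (qPoch_pos hq0 hq1 (2 * n + k)).ne'
    have h2 := (qPoch_pos hq0 hq1 n).ne'
    have h3 := (qPoch_pos hq0 hq1 (n + k)).ne'
    have h4 : (t ^ 4) ^ (n * (n + k)) * ((t ^ 4) ^ n)⁻¹ = t ^ (4 * ((n : ℤ) * (n + k) - n)) := by
      rw [← pow_mul, ← pow_mul, ← zpow_natCast, ← zpow_natCast, ← zpow_neg, ← em]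
      congr 1; push_cast; ring
    rw [h4, ← mul_div_assoc (t ^ ((k : ℤ) ^ 2 - 2 * k)), ← em,
      show (k : ℤ) ^ 2 - 2 * k + 4 * ((n : ℤ) * (n + k) - n)
        = ((n : ℤ) + ((n + k : ℕ) : ℤ)) ^ 2 - 2 * ((n : ℤ) + ((n + k : ℕ) : ℤ)) by push_cast; ring]
    field_simp
  · intro L hL
    have : qh (t ^ 4) L k = 0 := by
      by_contra hne
      apply hL
      have h1 := qh_ne_zero hne
      have h2 : Even ((L : ℤ) - k) := by
        by_contra h; exact hne (qh_odd _ h)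
      obtain ⟨c, hc⟩ := h2
      exact ⟨c.toNat, by simp only; omega⟩
    rw [this]; simp

lemma Lsum {t : ℝ} (ht0 : 0 < t) (ht1 : t < 1) (x : ℤ) :
    HasSum (fun L : ℕ => t ^ ((L : ℤ) ^ 2 - 2 * L) * qh (t ^ 4) L x / qPoch (t ^ 4) L)
      (t ^ (x ^ 2) * (t ^ (2 * x) + t ^ (-2 * x)) / qPochInf (t ^ 4)) := by
  obtain ⟨k, rfl | rfl⟩ := x.eq_nat_or_neg
  · exact Lsum_nat ht0 ht1 k
  · have := Lsum_nat ht0 ht1 k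
    simp only [qh_neg]
    convert this using 2
    rw [add_comm (t ^ (2 * -(k : ℤ))), show -2 * -(k : ℤ) = 2 * k by ring,
      show 2 * -(k : ℤ) = -2 * k by ring, neg_sq]

/-! ### Summing over `L` -/

lemma quad_summable {t : ℝ} (ht0 : 0 < t) (ht1 : t < 1) (A B C : ℤ) (hA : 1 ≤ A) :
    Summable fun j : ℤ => t ^ (A * j ^ 2 + B * j + C) := by
  have hnat : Summable fun m : ℕ => t ^ m := summable_geometric_of_lt_one ht0.le ht1
  have habs : Summable fun j : ℤ => t ^ j.natAbs := by
    apply Summable.of_nat_of_neg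
    · simpa using hnat
    · simpa using hnat
  refine Summable.of_nonneg_of_le (fun j => (zpow_pos ht0 _).le) (fun j => ?_)
    (habs.mul_left (t ^ (C - (|B| + 1) ^ 2)))
  rw [← zpow_natCast t j.natAbs, ← zpow_add₀ ht0.ne']
  apply zpow_le_zpow_right_of_le_one₀ ht0 ht1.le
  rw [Int.natCast_natAbs]
  have h1 : j ^ 2 = |j| ^ 2 := (sq_abs j).symm
  have h2 : -(|B| * |j|) ≤ B * j := by rw [← abs_mul]; exact neg_abs_le _
  have h3 : 0 ≤ |j| := abs_nonneg _
  have h4 : |j| ^ 2 ≤ A * j ^ 2 := by rw [h1]; nlinarith [sq_nonneg |j|]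
  nlinarith [sq_nonneg (2 * |j| - (|B| + 1)), sq_nonneg (|B| + 1)]

lemma swap_sum (f : ℕ → ℤ → ℝ) (hf : ∀ L j, 0 ≤ f L j) (g : ℤ → ℝ)
    (h : ∀ j, HasSum (fun L => f L j) (g j)) (hg : Summable g) :
    HasSum (fun L => ∑' j, f L j) (∑' j, g j) := by
  have hs : Summable fun x : ℤ × ℕ => f x.2 x.1 := by
    rw [summable_prod_of_nonneg (fun x => hf _ _)]
    exact ⟨fun j => (h j).summable, hg.congr fun j => (h j).tsum_eq.symm⟩
  have hs2 : Summable fun x : ℕ × ℤ => f x.1 x.2 := hs.prod_symm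
  have h1 := hs2.hasSum.prod_fiberwise (fun L => (hs2.prod_factor L).hasSum)
  have h2 := hs.hasSum.prod_fiberwise h
  have h3 : ∑' x : ℕ × ℤ, f x.1 x.2 = ∑' x : ℤ × ℕ, f x.2 x.1 :=
    ((Equiv.prodComm ℤ ℕ).tsum_eq (fun x : ℕ × ℤ => f x.1 x.2)).symm
  rw [h3, ← h2.tsum_eq] at h1
  exact h1

lemma chi_terms {t : ℝ} (ht0 : 0 < t) (ht1 : t < 1) (p r s : ℤ) (hp : 1 ≤ p) :
    (Summable fun j : ℤ => (t ^ 4) ^ (p * (p + 1) * j ^ 2 + j * ((p + 1) * r - p * s))) ∧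
    (Summable fun j : ℤ => (t ^ 4) ^ ((p * j + r) * ((p + 1) * j + s))) := by
  have hq0 : 0 < t ^ 4 := by positivity
  have hq1 : t ^ 4 < 1 := pow_lt_one₀ ht0.le ht1 (by norm_num)
  constructor
  · refine (quad_summable hq0 hq1 (p * (p + 1)) ((p + 1) * r - p * s) 0 (by nlinarith)).congr
      fun j => ?_
    congr 1; ring
  · refine (quad_summable hq0 hq1 (p * (p + 1)) ((p + 1) * r + p * s) (r * s) (by nlinarith)).congr
      fun j => ?_
    congr 1; ring

lemma chi_summable {t : ℝ} (ht0 : 0 < t) (ht1 : t < 1) (p r s : ℤ) (hp : 1 ≤ p) :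
    Summable fun j : ℤ => (t ^ 4) ^ (p * (p + 1) * j ^ 2 + j * ((p + 1) * r - p * s))
      - (t ^ 4) ^ ((p * j + r) * ((p + 1) * j + s)) :=
  (chi_terms ht0 ht1 p r s hp).1.sub (chi_terms ht0 ht1 p r s hp).2

lemma chi_eq {t : ℝ} (ht0 : 0 < t) (ht1 : t < 1) (p r s : ℤ) (hp : 1 ≤ p) :
    chiV p r s (t ^ 4) =
      ((∑' j : ℤ, (t ^ 4) ^ (p * (p + 1) * j ^ 2 + j * ((p + 1) * r - p * s)))
      - ∑' j : ℤ, (t ^ 4) ^ ((p * j + r) * ((p + 1) * j + s))) / qPochInf (t ^ 4) := by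
  unfold chiV
  rw [(chi_terms ht0 ht1 p r s hp).1.tsum_sub (chi_terms ht0 ht1 p r s hp).2]

lemma bos_half {t : ℝ} (ht0 : 0 < t) (ht1 : t < 1) (p a : ℤ) (x : ℤ → ℤ)
    (V : ℝ) (hV : HasSum (fun j => gam (t ^ 4) p a j *
      (t ^ (x j ^ 2) * (t ^ (2 * x j) + t ^ (-2 * x j)) / qPochInf (t ^ 4))) V) :
    HasSum (fun L : ℕ => t ^ ((L : ℤ) ^ 2 - 2 * L) / qPoch (t ^ 4) L *
      ∑' j, gam (t ^ 4) p a j * qh (t ^ 4) L (x j)) V := by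
  have hq0 : 0 < t ^ 4 := by positivity
  have hq1 : t ^ 4 < 1 := pow_lt_one₀ ht0.le ht1 (by norm_num)
  have := swap_sum (fun L j => gam (t ^ 4) p a j *
    (t ^ ((L : ℤ) ^ 2 - 2 * L) * qh (t ^ 4) L (x j) / qPoch (t ^ 4) L))
    (fun L j => by
      have h1 := gam_pos hq0 p a j
      have h2 := qh_nonneg hq0 hq1 L (x j)
      have h3 := qPoch_pos hq0 hq1 L
      have h4 : 0 < t ^ ((L : ℤ) ^ 2 - 2 * L) := zpow_pos ht0 _
      positivity) _
    (fun j => (Lsum ht0 ht1 (x j)).mul_left _) hV.summable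
  rw [hV.tsum_eq] at this
  refine this.congr_fun fun L => ?_
  rw [← tsum_mul_left]
  congr 1; funext j; ring

lemma bos_final {t : ℝ} (ht0 : 0 < t) (ht1 : t < 1) (p a b : ℤ) (hp : 1 ≤ p) :
    HasSum (fun L : ℕ => t ^ (b - a) * (t ^ ((L : ℤ) ^ 2 - 2 * L) / qPoch (t ^ 4) L *
      bo (t ^ 4) p a (b - 1) L))
      (t ^ ((b - a) * (b - a + 3)) * (chiV p a (b + 2) (t ^ 4)
        + t ^ (4 * (a - b)) * chiV p a b (t ^ 4))) := by
  have em : ∀ x y : ℤ, t ^ (x + y) = t ^ x * t ^ y := fun x y => zpow_add₀ ht0.ne' x y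
  have e4 : ∀ x : ℤ, (t ^ 4) ^ x = t ^ (4 * x) := fun x => by
    rw [zpow_mul]; norm_cast
  have dist : ∀ x y z w c u d v : ℤ, x + (y + z) = c + u → x + (y + w) = c + (d + v) →
      t ^ x * (t ^ y * (t ^ z + t ^ w)) = t ^ c * (t ^ u + t ^ d * t ^ v) := by
    intro x y z w c u d v h1 h2
    have h1' : t ^ x * (t ^ y * t ^ z) = t ^ c * t ^ u := by
      rw [← em, ← em, ← em, h1]
    have h2' : t ^ x * (t ^ y * t ^ w) = t ^ c * (t ^ d * t ^ v) := by
      rw [← em, ← em, ← em, ← em, h2]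
    linear_combination h1' + h2'
  obtain ⟨s1, s2⟩ := chi_terms ht0 ht1 p a (b + 2) hp
  obtain ⟨s3, s4⟩ := chi_terms ht0 ht1 p a b hp
  rw [chi_eq ht0 ht1 p a (b + 2) hp, chi_eq ht0 ht1 p a b hp]
  set S1 := ∑' j : ℤ, (t ^ 4) ^ (p * (p + 1) * j ^ 2 + j * ((p + 1) * a - p * (b + 2)))
  set S2 := ∑' j : ℤ, (t ^ 4) ^ ((p * j + a) * ((p + 1) * j + (b + 2)))
  set S3 := ∑' j : ℤ, (t ^ 4) ^ (p * (p + 1) * j ^ 2 + j * ((p + 1) * a - p * b))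
  set S4 := ∑' j : ℤ, (t ^ 4) ^ ((p * j + a) * ((p + 1) * j + b))
  have hA : HasSum (fun j => gam (t ^ 4) p a j * (t ^ ((b - 1 - (a - 1) - 2 * p * j) ^ 2) *
      (t ^ (2 * (b - 1 - (a - 1) - 2 * p * j)) + t ^ (-2 * (b - 1 - (a - 1) - 2 * p * j)))
        / qPochInf (t ^ 4)))
      (t ^ ((b - a) * (b - a + 2)) * (S1 + t ^ (4 * (a - b)) * S3) / qPochInf (t ^ 4)) := by
    refine (((s1.hasSum.add (s3.hasSum.mul_left (t ^ (4 * (a - b))))).mul_left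
      (t ^ ((b - a) * (b - a + 2)))).div_const _).congr_fun fun j => ?_
    rw [← mul_div_assoc]
    congr 1
    unfold gam
    rw [e4, e4, e4]
    exact dist _ _ _ _ _ _ _ _ (by ring) (by ring)
  have hB : HasSum (fun j => gam (t ^ 4) p a j * (t ^ ((b - 1 + a + 1 + 2 * p * (j - 1)) ^ 2) *
      (t ^ (2 * (b - 1 + a + 1 + 2 * p * (j - 1))) + t ^ (-2 * (b - 1 + a + 1 + 2 * p * (j - 1))))
        / qPochInf (t ^ 4)))
      (t ^ ((b - a) * (b - a + 2)) * (S2 + t ^ (4 * (a - b)) * S4) / qPochInf (t ^ 4)) := by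
    rw [← (Equiv.addRight (1 : ℤ)).hasSum_iff]
    refine (((s2.hasSum.add (s4.hasSum.mul_left (t ^ (4 * (a - b))))).mul_left
      (t ^ ((b - a) * (b - a + 2)))).div_const _).congr_fun fun j => ?_
    simp only [Function.comp, Equiv.coe_addRight]
    rw [← mul_div_assoc]
    congr 1
    unfold gam
    rw [e4, e4, e4]
    exact dist _ _ _ _ _ _ _ _ (by ring) (by ring)
  have hA' := bos_half ht0 ht1 p a _ _ hA
  have hB' := bos_half ht0 ht1 p a _ _ hB
  have := (hA'.sub hB').mul_left (t ^ (b - a))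
  have e : ∀ X Y U : ℝ, t ^ ((b - a) * (b - a + 3)) * ((X - Y) / U) =
      t ^ (b - a) * (t ^ ((b - a) * (b - a + 2)) * X / U
        - t ^ ((b - a) * (b - a + 2)) * Y / U) := by
    intro X Y U
    rw [show (b - a) * (b - a + 3) = (b - a) + (b - a) * (b - a + 2) by ring, em]
    ring
  have e' := e (S1 + t ^ (4 * (a - b)) * S3) (S2 + t ^ (4 * (a - b)) * S4) (qPochInf (t ^ 4))
  rw [← e'] at this
  have e2 : (S1 - S2) / qPochInf (t ^ 4) + t ^ (4 * (a - b)) * ((S3 - S4) / qPochInf (t ^ 4)) =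
      ((S1 + t ^ (4 * (a - b)) * S3) - (S2 + t ^ (4 * (a - b)) * S4)) / qPochInf (t ^ 4) := by
    ring
  rw [e2]
  refine this.congr_fun fun L => ?_
  rw [← mul_sub]
  congr 2
  unfold bo
  rw [← (bt_summable1 (t ^ 4) p a (b - 1) L hp).tsum_sub
    (bt_summable2 (t ^ 4) p a (b - 1) L hp)]
  congr 1; funext j; unfold bt; ring

/-! ### Final assembly -/

lemma qBinQ_eq (q : ℝ) (N : ℤ) (m : ℕ) : qBinQ q ((N : ℚ) / 2) m = qb2 q N m := by
  unfold qb2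
  split_ifs with h
  · obtain ⟨c, hc⟩ := h
    have h1 : (N : ℚ) / 2 = (c : ℚ) := by subst hc; push_cast; ring
    have h2 : N / 2 = c := by omega
    rw [h1, h2]
    unfold qBinQ qb
    have h3 : ((m : ℚ) ≤ (c : ℚ)) ↔ ((m : ℤ) ≤ c) := by
      rw [← Int.cast_natCast]; exact Int.cast_le
    simp only [Rat.den_intCast, Rat.num_intCast, true_and, h3, Int.natCast_nonneg, Int.toNat_natCast]
    split_ifs with h4
    · congr 3; omega
    · rfl
  · unfold qBinQ
    rw [if_neg]
    rintro ⟨h1, -⟩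
    have h2 : ((((N : ℚ) / 2).num : ℤ) : ℚ) = (N : ℚ) / 2 := Rat.coe_int_num_of_den_eq_one h1
    apply h
    refine ⟨((N : ℚ) / 2).num, ?_⟩
    have h3 : (N : ℚ) = (((N : ℚ) / 2).num : ℚ) + (((N : ℚ) / 2).num : ℚ) := by
      rw [h2]; ring
    exact_mod_cast h3

lemma sum_pick {N : ℕ} (m : Fin N → ℕ) (k : ℕ) :
    ∑ j : Fin N, (if j.val = k then (m j : ℚ) else 0) = ((ex m (k + 1) : ℤ) : ℚ) := by
  simp only [ex]
  split_ifs with h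
  · rw [Finset.sum_eq_single (⟨k, h⟩ : Fin N)]
    · simp
    · intro j _ hj
      rw [if_neg]
      intro h'; apply hj; ext; exact h'
    · simp
  · rw [Finset.sum_eq_zero]
    · simp
    · intro j _
      rw [if_neg]
      have := j.2
      omega

lemma inc_sum {n : ℕ} (m : Fin (n + 1) → ℕ) (i : Fin (n + 1)) :
    ∑ j : Fin (n + 1), IncA (n + 3) i j * (m j : ℚ)
      = ((ex m i.val + ex m (i.val + 2) : ℤ) : ℚ) := by
  rw [Int.cast_add, ← sum_pick m (i.val + 1)]
  have h : ((ex m i.val : ℤ) : ℚ) = ∑ j : Fin (n + 1), (if i.val = j.val + 1 then (m j : ℚ) else 0) := by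
    rcases hi : i.val with _ | k
    · rw [Finset.sum_eq_zero]
      · simp [ex]
      · intro j _
        rw [if_neg]; omega
    · rw [← sum_pick]
      refine Finset.sum_congr rfl fun j _ => ?_
      refine if_congr ?_ rfl rfl
      omega
  rw [h, ← Finset.sum_add_distrib]
  refine Finset.sum_congr rfl fun j _ => ?_
  unfold IncA
  by_cases h1 : i.val = j.val + 1
  · have h2 : ¬ j.val = i.val + 1 := by omega
    have h3 : ¬ j.val = j.val + 1 + 1 := by omega
    simp [h1, h3]
  · by_cases h2 : j.val = i.val + 1
    · have h3 : ¬ i.val = i.val + 1 + 1 := by omega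
      simp [h2, h3]
    · simp [h1, h2]

lemma car_sum {n : ℕ} (m : Fin (n + 1) → ℕ) :
    ∑ i : Fin (n + 1), ∑ j : Fin (n + 1), (m i : ℚ) * CarA (n + 3) i j * (m j : ℚ)
      = ((∑ i ∈ range (n + 1), ex m (i + 1) * (2 * ex m (i + 1) - ex m i - ex m (i + 2)) : ℤ) : ℚ) := by
  rw [← Fin.sum_univ_eq_sum_range
    (fun i => ex m (i + 1) * (2 * ex m (i + 1) - ex m i - ex m (i + 2))), Int.cast_sum]
  refine Finset.sum_congr rfl fun i _ => ?_
  have h1 : ex m (i.val + 1) = (m i : ℤ) := by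
    simp only [ex]; rw [dif_pos i.2]
  have h2 := inc_sum m i
  have h3 : ∑ j : Fin (n + 1), (m i : ℚ) * CarA (n + 3) i j * (m j : ℚ)
      = (m i : ℚ) * (2 * m i - ∑ j : Fin (n + 1), IncA (n + 3) i j * (m j : ℚ)) := by
    have h4 : (2 * m i : ℚ) = ∑ j : Fin (n + 1), (if i = j then (2 : ℚ) else 0) * (m j : ℚ) := by
      simp
    rw [h4, ← Finset.sum_sub_distrib, Finset.mul_sum]
    refine Finset.sum_congr rfl fun j _ => ?_
    have : CarA (n + 3) i j = (if i = j then (2 : ℚ) else 0) - IncA (n + 3) i j := rfl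
    rw [this]; ring
  rw [h3, h2, h1]
  push_cast
  ring

lemma ex_cons {n : ℕ} (L : ℕ) (m : Fin n → ℕ) (i : ℕ) :
    ex (Fin.cons L m : Fin (n + 1) → ℕ) (i + 1) = ex m i + L * ev 0 i := by
  rcases i with _ | i
  · simp [ex, ev]
  · simp only [ex, ev, Nat.add_lt_add_iff_right]
    rw [if_neg (Nat.succ_ne_zero i), mul_zero, add_zero]
    split_ifs with h
    · have : (⟨i + 1, by omega⟩ : Fin (n + 1)) = Fin.succ ⟨i, h⟩ := rfl
      rw [this, Fin.cons_succ]
    · rfl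

lemma EE_cons {n : ℕ} (hn : 1 ≤ n) (b L : ℕ) (hb : 1 ≤ b) (hbn : b ≤ n) (m : Fin n → ℕ) :
    ∑ i ∈ range (n + 1), ex (Fin.cons L m : Fin (n + 1) → ℕ) (i + 1) *
      (2 * ex (Fin.cons L m : Fin (n + 1) → ℕ) (i + 1) - ex (Fin.cons L m : Fin (n + 1) → ℕ) i
        - ex (Fin.cons L m : Fin (n + 1) → ℕ) (i + 2)) - 2 * ex m b
      = 2 * (L : ℤ) ^ 2 + EE n (uL L b) (ex m) := by
  rw [Finset.sum_range_succ']
  simp only [ex_cons]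
  unfold EE
  have hz : ∀ i : ℕ, ev 0 (i + 1) = 0 := fun i => by simp [ev]
  have h0 : ev 0 0 = 1 := by simp [ev]
  have key : ∀ (f : ℕ → ℤ) (k : ℕ), 1 ≤ k → k ≤ n →
      ∑ i ∈ range n, f (i + 1) * ev k (i + 1) = f k := by
    intro f k hk1 hk2
    rw [Finset.sum_eq_single (k - 1)]
    · have : k - 1 + 1 = k := by omega
      simp [this, ev]
    · intro j _ hj
      have : ¬ (j + 1 = k) := by omega
      simp [ev, this]
    · intro h; simp at h; omega
  have e1 := key (ex m) 1 le_rfl hn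
  have e2 := key (ex m) b hb hbn
  have hev : ∀ i : ℕ, ev 1 (i + 1) = ev 0 i := fun i => by simp [ev]
  have hs : ∑ i ∈ range n, (ex m (i + 1) + (L : ℤ) * ev 0 (i + 1)) *
      (2 * (ex m (i + 1) + (L : ℤ) * ev 0 (i + 1)) - (ex m i + (L : ℤ) * ev 0 i)
        - (ex m (i + 1 + 1) + (L : ℤ) * ev 0 (i + 1 + 1)))
      = ∑ i ∈ range n, ex m (i + 1) *
        (2 * ex m (i + 1) - ex m i - ex m (i + 2) - 2 * uL L b (i + 1))
        + L * (∑ i ∈ range n, ex m (i + 1) * ev 1 (i + 1))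
        + 2 * (∑ i ∈ range n, ex m (i + 1) * ev b (i + 1)) := by
    rw [Finset.mul_sum, Finset.mul_sum, ← Finset.sum_add_distrib, ← Finset.sum_add_distrib]
    refine Finset.sum_congr rfl fun i _ => ?_
    rw [hz, hz]
    unfold uL
    rw [hev]
    ring
  rw [hs, e1, e2, h0, hz]
  simp only [ex_zero]
  ring

def FT (n a b : ℕ) (hb : b < n + 1) (q : ℝ) (m : Fin (n + 1) → ℕ) : ℝ :=
  if m ⟨n, by omega⟩ % 2 = 0 then
    q ^ ((((∑ i : Fin (n + 1), ∑ j : Fin (n + 1), (m i : ℚ) * CarA (n + 3) i j * (m j : ℚ)) / 4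
        - (m ⟨0, by omega⟩ : ℚ) / 2 - (m ⟨b, hb⟩ : ℚ) / 2 : ℚ) : ℝ))
      * (1 / qPoch q (m ⟨0, by omega⟩))
      * ∏ i ∈ Finset.univ.filter (fun i : Fin (n + 1) => i.val ≠ 0),
          qBinQ q ((∑ j : Fin (n + 1), IncA (n + 3) i j * (m j : ℚ)) / 2
            + ((if i.val + 1 = a + 1 then (1 : ℚ) else 0)
                + (if i.val + 1 = b + 1 then (1 : ℚ) else 0)) / 2) (m i)
  else 0

lemma FT_cons {n : ℕ} {t : ℝ} (ht0 : 0 < t) (hn : 1 ≤ n) (a b L : ℕ)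
    (hb : 1 ≤ b) (hbn : b ≤ n) (hb' : b < n + 1) (m : Fin n → ℕ) :
    FT n a b hb' (t ^ 4) (Fin.cons L m)
      = t ^ (2 * (L : ℤ) ^ 2 - 2 * L) / qPoch (t ^ 4) L * TT n t (ev a) (uL L b) (ex m) := by
  have hat : ∀ (k : ℕ) (hk : k < n + 1), 1 ≤ k →
      (((Fin.cons L m : Fin (n + 1) → ℕ) ⟨k, hk⟩ : ℕ) : ℤ) = ex m k := by
    intro k hk h1
    have h2 := ex_cons L m k
    have h3 : ex (Fin.cons L m : Fin (n + 1) → ℕ) (k + 1)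
        = (((Fin.cons L m : Fin (n + 1) → ℕ) ⟨k, hk⟩ : ℕ) : ℤ) := dif_pos hk
    have h4 : ev 0 k = 0 := if_neg (by omega)
    rw [← h3, h2, h4, mul_zero, add_zero]
  have hpar : ((Fin.cons L m : Fin (n + 1) → ℕ) ⟨n, by omega⟩ % 2 = 0) ↔
      Even (ex m n + uL L b (n + 1)) := by
    have h1 := hat n (by omega) hn
    have h2 : uL L b (n + 1) = 0 := by
      have h3 : ¬ n + 1 = b := by omega
      have h4 : ¬ n = 0 := by omega
      simp [uL, ev, h3, h4]
    rw [h2, add_zero, ← h1, Int.even_iff]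
    omega
  unfold FT TT
  by_cases hE : Even (ex m n + uL L b (n + 1))
  swap
  · rw [if_neg (mt hpar.1 hE), if_neg hE]; ring
  rw [if_pos (hpar.2 hE), if_pos hE, car_sum]
  have hexp : (t ^ 4) ^ (((((∑ i ∈ range (n + 1), ex (Fin.cons L m : Fin (n + 1) → ℕ) (i + 1) *
      (2 * ex (Fin.cons L m : Fin (n + 1) → ℕ) (i + 1) - ex (Fin.cons L m : Fin (n + 1) → ℕ) i
        - ex (Fin.cons L m : Fin (n + 1) → ℕ) (i + 2)) : ℤ) : ℚ) / 4
        - ((Fin.cons L m : Fin (n + 1) → ℕ) ⟨0, by omega⟩ : ℚ) / 2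
        - ((Fin.cons L m : Fin (n + 1) → ℕ) ⟨b, hb'⟩ : ℚ) / 2 : ℚ) : ℝ))
      = t ^ (2 * (L : ℤ) ^ 2 - 2 * L) * t ^ EE n (uL L b) (ex m) := by
    have h1 := hat b hb' hb
    have h2 : (((Fin.cons L m : Fin (n + 1) → ℕ) ⟨b, hb'⟩ : ℕ) : ℚ) = ((ex m b : ℤ) : ℚ) := by
      rw [← h1]; simp
    have h3 : (Fin.cons L m : Fin (n + 1) → ℕ) ⟨0, by omega⟩ = L := rfl
    have h4 := EE_cons hn b L hb hbn m
    rw [h2, h3, ← zpow_add₀ ht0.ne', ← Real.rpow_natCast t 4, ← Real.rpow_mul ht0.le,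
      ← Real.rpow_intCast]
    congr 1
    rw [show 2 * (L : ℤ) ^ 2 - 2 * L + EE n (uL L b) (ex m)
      = (2 * (L : ℤ) ^ 2 + EE n (uL L b) (ex m)) - 2 * L by ring, ← h4]
    push_cast
    ring
  rw [hexp]
  have hprod : ∏ i ∈ Finset.univ.filter (fun i : Fin (n + 1) => i.val ≠ 0),
          qBinQ (t ^ 4) ((∑ j : Fin (n + 1), IncA (n + 3) i j *
            ((Fin.cons L m : Fin (n + 1) → ℕ) j : ℚ)) / 2
            + ((if i.val + 1 = a + 1 then (1 : ℚ) else 0)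
                + (if i.val + 1 = b + 1 then (1 : ℚ) else 0)) / 2)
                  ((Fin.cons L m : Fin (n + 1) → ℕ) i)
      = ∏ i ∈ range n, qb2 (t ^ 4) (ex m i + ex m (i + 2) + uL L b (i + 1) + ev a (i + 1))
          (ex m (i + 1)) := by
    rw [Finset.prod_filter, Fin.prod_univ_succ, if_neg (by simp), one_mul,
      ← Fin.prod_univ_eq_prod_range (fun i => qb2 (t ^ 4)
        (ex m i + ex m (i + 2) + uL L b (i + 1) + ev a (i + 1)) (ex m (i + 1)))]
    refine Finset.prod_congr rfl fun i _ => ?_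
    rw [if_pos (by simp), inc_sum]
    have h1 := hat (i.val + 1) (by omega) (by omega)
    rw [← h1, ← qBinQ_eq]
    have h2 : (Fin.cons L m : Fin (n + 1) → ℕ) i.succ
      = (Fin.cons L m : Fin (n + 1) → ℕ) ⟨i.val + 1, by omega⟩ := rfl
    rw [h2]
    congr 1
    rw [Fin.val_succ, ex_cons, ex_cons]
    have hz : ev 0 (i.val + 2) = 0 := by simp [ev]
    have hev : ev 1 (i.val + 1) = ev 0 i.val := by simp [ev]
    have ha1 : (if i.val + 1 + 1 = a + 1 then (1 : ℚ) else 0) = ((ev a (i.val + 1) : ℤ) : ℚ) := by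
      simp [ev]
    have hb1 : (if i.val + 1 + 1 = b + 1 then (1 : ℚ) else 0) = ((ev b (i.val + 1) : ℤ) : ℚ) := by
      simp [ev]
    rw [ha1, hb1]
    unfold uL
    rw [hev]
    have hz' : ev 0 (i.val + 1 + 1) = 0 := hz
    rw [hz']
    push_cast
    ring
  rw [hprod]
  have h3 : (Fin.cons L m : Fin (n + 1) → ℕ) ⟨0, by omega⟩ = L := rfl
  rw [h3]
  ring

lemma TT_nonneg {n : ℕ} {t : ℝ} (ht0 : 0 < t) (ht1 : t < 1) (A u X : ℕ → ℤ) :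
    0 ≤ TT n t A u X := by
  have hq0 : 0 < t ^ 4 := by positivity
  have hq1 : t ^ 4 < 1 := pow_lt_one₀ ht0.le ht1 (by norm_num)
  unfold TT
  refine mul_nonneg (mul_nonneg ?_ (zpow_pos ht0 _).le)
    (Finset.prod_nonneg fun i _ => qb2_nonneg hq0 hq1 _ _)
  split_ifs <;> norm_num

lemma FT_hasSum {n : ℕ} {t : ℝ} (ht0 : 0 < t) (ht1 : t < 1) (hn : 1 ≤ n) (a b : ℕ)
    (ha : 1 ≤ a) (han : a ≤ n) (hb : 1 ≤ b) (hbn : b ≤ n) (hb' : b < n + 1) (V : ℝ)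
    (hV : HasSum (fun L : ℕ => t ^ ((b : ℤ) - a) * (t ^ ((L : ℤ) ^ 2 - 2 * L) / qPoch (t ^ 4) L *
      bo (t ^ 4) (n + 3) (a + 1) b L)) V) :
    HasSum (FT n a b hb' (t ^ 4)) V := by
  have hq0 : 0 < t ^ 4 := by positivity
  have hq1 : t ^ 4 < 1 := pow_lt_one₀ ht0.le ht1 (by norm_num)
  let e : ℕ × (Fin n → ℕ) ≃ (Fin (n + 1) → ℕ) := Fin.consEquiv (fun _ => ℕ)
  rw [← e.hasSum_iff]
  have hfun : (FT n a b hb' (t ^ 4)) ∘ e = fun x : ℕ × (Fin n → ℕ) =>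
      t ^ (2 * (x.1 : ℤ) ^ 2 - 2 * x.1) / qPoch (t ^ 4) x.1 * TT n t (ev a) (uL x.1 b) (ex x.2) := by
    funext x
    exact FT_cons ht0 hn a b x.1 hb hbn hb' x.2
  rw [hfun]
  have hfib : ∀ L : ℕ, HasSum (fun m : Fin n → ℕ =>
      t ^ (2 * (L : ℤ) ^ 2 - 2 * L) / qPoch (t ^ 4) L * TT n t (ev a) (uL L b) (ex m))
      (t ^ ((b : ℤ) - a) * (t ^ ((L : ℤ) ^ 2 - 2 * L) / qPoch (t ^ 4) L *
      bo (t ^ 4) (n + 3) (a + 1) b L)) := by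
    intro L
    have h1 := (TT_summable n (t := t) (ev a) (uL L b)).hasSum.mul_left
      (t ^ (2 * (L : ℤ) ^ 2 - 2 * L) / qPoch (t ^ 4) L)
    have h2 := GG_eq_bo n ht0 ht1 a ha han L b hb (by omega)
    unfold GG at h2
    rw [h2] at h1
    have h3 : t ^ (2 * (L : ℤ) ^ 2 - 2 * L) * t ^ ((b : ℤ) - (L : ℤ) ^ 2 - a)
        = t ^ ((b : ℤ) - a) * t ^ ((L : ℤ) ^ 2 - 2 * L) := by
      rw [← zpow_add₀ ht0.ne', ← zpow_add₀ ht0.ne']; congr 1; ring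
    have h4 : t ^ (2 * (L : ℤ) ^ 2 - 2 * L) / qPoch (t ^ 4) L *
        (t ^ ((b : ℤ) - (L : ℤ) ^ 2 - a) * bo (t ^ 4) (n + 3) (a + 1) b L)
        = t ^ ((b : ℤ) - a) * (t ^ ((L : ℤ) ^ 2 - 2 * L) / qPoch (t ^ 4) L *
          bo (t ^ 4) (n + 3) (a + 1) b L) := by
      linear_combination (bo (t ^ 4) (n + 3) (a + 1) b L / qPoch (t ^ 4) L) * h3
    rw [h4] at h1
    exact h1
  have hsum : Summable fun x : ℕ × (Fin n → ℕ) =>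
      t ^ (2 * (x.1 : ℤ) ^ 2 - 2 * x.1) / qPoch (t ^ 4) x.1 * TT n t (ev a) (uL x.1 b) (ex x.2) := by
    rw [summable_prod_of_nonneg]
    · refine ⟨fun L => (hfib L).summable, ?_⟩
      refine hV.summable.congr fun L => ?_
      exact (hfib L).tsum_eq.symm
    · intro x
      exact mul_nonneg (div_nonneg (zpow_pos ht0 _).le (qPoch_pos hq0 hq1 _).le)
        (TT_nonneg ht0 ht1 _ _ _)
  have h := hsum.hasSum.prod_fiberwise hfib
  rw [← h.unique hV]
  exact hsum.hasSum

/-- The extended-character identity obtained by summing out `m₁`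
(via the `q`-Chu–Vandermonde formula): for `p ≥ 4`, `2 ≤ a ≤ p-2`, `2 ≤ b ≤ p-2`
with `a + b` odd, and `0 < q < 1`,
`Σ_m q^{(m·Cm)/4 - m₁/2 - m_b/2} (1/(q)_{m₁})
   ∏_{j=2}^{p-2} [(½Im)_j + ½(δ_{a,j}+δ_{b,j}) choose m_j]_q
  = q^{φ̃(a,b)} (χ^{p,p+1}_{a,b+2}(q) + q^{a-b} χ^{p,p+1}_{a,b}(q))`,
the sum over all `m = (m₁,…,m_{p-2}) ∈ ℤ^{p-2}_{≥0}` with `m_{p-2}` even;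
both sides converge absolutely. -/
theorem extended_character_identity_summed (p a b : ℕ) (hp : 4 ≤ p)
    (ha1 : 2 ≤ a) (ha2 : a ≤ p - 2) (hb1 : 2 ≤ b) (hb2 : b ≤ p - 2)
    (hab : (a + b) % 2 = 1) (q : ℝ) (hq0 : 0 < q) (hq1 : q < 1) :
    Summable (fun m : Fin (p - 2) → ℕ =>
      if m ⟨p - 3, by omega⟩ % 2 = 0 then
        q ^ ((((∑ i, ∑ j, (m i : ℚ) * CarA p i j * (m j : ℚ)) / 4
            - (m ⟨0, by omega⟩ : ℚ) / 2 - (m ⟨b - 1, by omega⟩ : ℚ) / 2 : ℚ) : ℝ))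
          * (1 / qPoch q (m ⟨0, by omega⟩))
          * ∏ i ∈ Finset.univ.filter (fun i : Fin (p - 2) => i.val ≠ 0),
              qBinQ q ((∑ j, IncA p i j * (m j : ℚ)) / 2
                + ((if i.val + 1 = a then (1 : ℚ) else 0)
                    + (if i.val + 1 = b then (1 : ℚ) else 0)) / 2) (m i)
      else 0) ∧
    Summable (fun j : ℤ =>
      q ^ ((p : ℤ) * ((p : ℤ) + 1) * j ^ 2 + j * (((p : ℤ) + 1) * a - (p : ℤ) * ((b : ℤ) + 2)))
        - q ^ (((p : ℤ) * j + a) * (((p : ℤ) + 1) * j + ((b : ℤ) + 2)))) ∧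
    Summable (fun j : ℤ =>
      q ^ ((p : ℤ) * ((p : ℤ) + 1) * j ^ 2 + j * (((p : ℤ) + 1) * a - (p : ℤ) * b))
        - q ^ (((p : ℤ) * j + a) * (((p : ℤ) + 1) * j + b))) ∧
    (∑' m : Fin (p - 2) → ℕ,
      if m ⟨p - 3, by omega⟩ % 2 = 0 then
        q ^ ((((∑ i, ∑ j, (m i : ℚ) * CarA p i j * (m j : ℚ)) / 4
            - (m ⟨0, by omega⟩ : ℚ) / 2 - (m ⟨b - 1, by omega⟩ : ℚ) / 2 : ℚ) : ℝ))
          * (1 / qPoch q (m ⟨0, by omega⟩))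
          * ∏ i ∈ Finset.univ.filter (fun i : Fin (p - 2) => i.val ≠ 0),
              qBinQ q ((∑ j, IncA p i j * (m j : ℚ)) / 2
                + ((if i.val + 1 = a then (1 : ℚ) else 0)
                    + (if i.val + 1 = b then (1 : ℚ) else 0)) / 2) (m i)
      else 0)
      = q ^ (phitR (a : ℝ) (b : ℝ))
          * (chiV p a ((b : ℤ) + 2) q + q ^ ((a : ℝ) - (b : ℝ)) * chiV p a b q) := by
  obtain ⟨n, rfl⟩ : ∃ n, p = n + 3 := ⟨p - 3, by omega⟩
  obtain ⟨a, rfl⟩ : ∃ a', a = a' + 1 := ⟨a - 1, by omega⟩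
  obtain ⟨b, rfl⟩ : ∃ b', b = b' + 1 := ⟨b - 1, by omega⟩
  obtain ⟨t, ht0, ht1, rfl⟩ : ∃ t : ℝ, 0 < t ∧ t < 1 ∧ q = t ^ 4 := by
    refine ⟨q ^ ((1 : ℝ) / 4), Real.rpow_pos_of_pos hq0 _,
      Real.rpow_lt_one hq0.le hq1 (by norm_num), ?_⟩
    rw [← Real.rpow_natCast, ← Real.rpow_mul hq0.le]
    norm_num
  have hb' : b < n + 1 := by omega
  have hV := bos_final ht0 ht1 ((n : ℤ) + 3) ((a : ℤ) + 1) ((b : ℤ) + 1) (by omega)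
  rw [show (b : ℤ) + 1 - (a + 1) = b - a by ring, show (b : ℤ) + 1 - 1 = b by ring] at hV
  have hF := FT_hasSum ht0 ht1 (by omega) a b (by omega) (by omega) (by omega) (by omega) hb' _ hV
  have hc1 := chi_summable ht0 ht1 ((n + 3 : ℕ) : ℤ) ((a + 1 : ℕ) : ℤ) (((b + 1 : ℕ) : ℤ) + 2)
    (by omega)
  have hc2 := chi_summable ht0 ht1 ((n + 3 : ℕ) : ℤ) ((a + 1 : ℕ) : ℤ) ((b + 1 : ℕ) : ℤ)
    (by omega)
  refine ⟨hF.summable, hc1, hc2, ?_⟩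
  refine Eq.trans hF.tsum_eq ?_
  have e1 : (t ^ 4) ^ (phitR ((a + 1 : ℕ) : ℝ) ((b + 1 : ℕ) : ℝ))
      = t ^ (((b : ℤ) - a) * ((b : ℤ) - a + 3)) := by
    rw [← Real.rpow_natCast t 4, ← Real.rpow_mul ht0.le, ← Real.rpow_intCast]
    congr 1
    unfold phitR
    push_cast
    ring
  have e2 : (t ^ 4) ^ (((a + 1 : ℕ) : ℝ) - ((b + 1 : ℕ) : ℝ))
      = t ^ (4 * ((a : ℤ) + 1 - ((b : ℤ) + 1))) := by
    rw [← Real.rpow_natCast t 4, ← Real.rpow_mul ht0.le, ← Real.rpow_intCast]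
    congr 1
    push_cast
    ring
  rw [e1, e2]
  push_cast
  rfl
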